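/- arXiv:1411.2049 — 11 statements merged into one kernel-verified Lean document; each statement's English description precedes it below -/
import Mathlib

section
/- Let k₁₂, k₁₃, k₁₄, k₂₃, k₂₄, k₃₄ be nonnegative integers with k₁₄ ≥ 1 and k₂₃ ≥ 1. For a 6-tuple m = (m₁₂,m₁₃,m₁₄,m₂₃,m₂₄,m₃₄) of nonnegative integers define P_m : (ℂ²)⁴ → ℂ by P_m(z₁,z₂,z₃,z₄) := ∏_{1≤i<j≤4} [z_i|z_j⟩^{m_ij} / (m_ij)!. Then for all z₁,z₂,z₃,z₄ ∈ ℂ²: (k₁₂+1)(k₃₄+1)·P_{(k₁₂+1, k₁₃, k₁₄−1, k₂₃−1, k₂₄, k₃₄+1)}(z) − (k₁₃+1)(k₂₄+1)·P_{(k₁₂, k₁₃+1, k₁₄−1, k₂₃−1, k₂₄+1, k₃₄)}(z) + k₁₄·k₂₃·P_{(k₁₂,k₁₃,k₁₄,k₂₃,k₂₄,k₃₄)}(z) = 0. (This is the fundamental linear relation among the discrete-coherent 4-valent intertwiner states |S,T⟩, generated by the Plücker relation.) -/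
/-!
STATEMENT 0: the fundamental linear relation among the discrete-coherent
4-valent intertwiner states, generated by the Plücker relation.
-/

noncomputable section

/-- A spinor is an element of ℂ². -/
abbrev Spinor := Fin 2 → ℂ

/-- The holomorphic bracket `[z|w⟩ = z₀w₁ − z₁w₀`. -/
def bra (z w : Spinor) : ℂ := z 0 * w 1 - z 1 * w 0

/-- The monomial `P_m(z₁,z₂,z₃,z₄) = ∏_{i<j} [z_i|z_j⟩^{m_ij}/(m_ij)!`. -/
def Pmono (m12 m13 m14 m23 m24 m34 : ℕ) (z1 z2 z3 z4 : Spinor) : ℂ :=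
    (bra z1 z2 ^ m12 / (Nat.factorial m12 : ℂ)) *
    (bra z1 z3 ^ m13 / (Nat.factorial m13 : ℂ)) *
    (bra z1 z4 ^ m14 / (Nat.factorial m14 : ℂ)) *
    (bra z2 z3 ^ m23 / (Nat.factorial m23 : ℂ)) *
    (bra z2 z4 ^ m24 / (Nat.factorial m24 : ℂ)) *
    (bra z3 z4 ^ m34 / (Nat.factorial m34 : ℂ))

/-- The Plücker relation among the brackets of four spinors. -/
theorem bra_plucker (z1 z2 z3 z4 : Spinor) :
    bra z1 z2 * bra z3 z4 - bra z1 z3 * bra z2 z4 + bra z1 z4 * bra z2 z3 = 0 := by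
  simp only [bra]
  ring

theorem succ_mul_pow_succ_div_factorial (x : ℂ) (n : ℕ) :
    ((n : ℂ) + 1) * (x ^ (n + 1) / (Nat.factorial (n + 1) : ℂ)) =
      x * (x ^ n / (Nat.factorial n : ℂ)) := by
  have h : (n : ℂ) + 1 ≠ 0 := Nat.cast_add_one_ne_zero n
  rw [Nat.factorial_succ]
  push_cast
  field_simp
  ring

theorem fundamental_relation (k12 k13 k14 k23 k24 k34 : ℕ)
    (h14 : 1 ≤ k14) (h23 : 1 ≤ k23) (z1 z2 z3 z4 : Spinor) :
    ((k12 : ℂ) + 1) * ((k34 : ℂ) + 1) *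
        Pmono (k12 + 1) k13 (k14 - 1) (k23 - 1) k24 (k34 + 1) z1 z2 z3 z4
      - ((k13 : ℂ) + 1) * ((k24 : ℂ) + 1) *
        Pmono k12 (k13 + 1) (k14 - 1) (k23 - 1) (k24 + 1) k34 z1 z2 z3 z4
      + (k14 : ℂ) * (k23 : ℂ) *
        Pmono k12 k13 k14 k23 k24 k34 z1 z2 z3 z4 = 0 := by
  obtain ⟨a, rfl⟩ := Nat.exists_eq_add_of_le' h14
  obtain ⟨b, rfl⟩ := Nat.exists_eq_add_of_le' h23
  simp only [Nat.add_sub_cancel, Pmono, Nat.cast_add, Nat.cast_one]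
  have e12 := succ_mul_pow_succ_div_factorial (bra z1 z2) k12
  have e13 := succ_mul_pow_succ_div_factorial (bra z1 z3) k13
  have e14 := succ_mul_pow_succ_div_factorial (bra z1 z4) a
  have e23 := succ_mul_pow_succ_div_factorial (bra z2 z3) b
  have e24 := succ_mul_pow_succ_div_factorial (bra z2 z4) k24
  have e34 := succ_mul_pow_succ_div_factorial (bra z3 z4) k34
  have hp := bra_plucker z1 z2 z3 z4
  generalize bra z1 z2 ^ (k12 + 1) / (Nat.factorial (k12 + 1) : ℂ) = Q12 at *
  generalize bra z1 z3 ^ (k13 + 1) / (Nat.factorial (k13 + 1) : ℂ) = Q13 at *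
  generalize bra z1 z4 ^ (a + 1) / (Nat.factorial (a + 1) : ℂ) = Q14 at *
  generalize bra z2 z3 ^ (b + 1) / (Nat.factorial (b + 1) : ℂ) = Q23 at *
  generalize bra z2 z4 ^ (k24 + 1) / (Nat.factorial (k24 + 1) : ℂ) = Q24 at *
  generalize bra z3 z4 ^ (k34 + 1) / (Nat.factorial (k34 + 1) : ℂ) = Q34 at *
  generalize bra z1 z2 ^ k12 / (Nat.factorial k12 : ℂ) = R12 at *
  generalize bra z1 z3 ^ k13 / (Nat.factorial k13 : ℂ) = R13 at *
  generalize bra z1 z4 ^ a / (Nat.factorial a : ℂ) = R14 at *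
  generalize bra z2 z3 ^ b / (Nat.factorial b : ℂ) = R23 at *
  generalize bra z2 z4 ^ k24 / (Nat.factorial k24 : ℂ) = R24 at *
  generalize bra z3 z4 ^ k34 / (Nat.factorial k34 : ℂ) = R34 at *
  linear_combination
    R13 * R14 * R23 * R24 * (((k34 : ℂ) + 1) * Q34 * e12 + bra z1 z2 * R12 * e34)
      - R12 * R14 * R23 * R34 * (((k24 : ℂ) + 1) * Q24 * e13 + bra z1 z3 * R13 * e24)
      + R12 * R13 * R24 * R34 * (((b : ℂ) + 1) * Q23 * e14 + bra z1 z4 * R14 * e23)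
      + R12 * R13 * R14 * R23 * R24 * R34 * hp
end
end

section
/- Let n ≥ 1 and d : {1,…,n} → ℕ. For [k] ∈ K_d define C_[k] : (ℂ²)ⁿ → ℂ by C_[k](z₁,…,zₙ) := ∏_{1≤i<j≤n} [z_i|z_j⟩^{k_ij} / (k_ij)! and set ‖[k]‖² := (J+1)! / ∏_{i<j} (k_ij)!. Then for every [k'] ∈ K_d and every (z₁,…,zₙ) ∈ (ℂ²)ⁿ: Σ_{[k]∈K_d} ‖[k]‖⁻² · ( ∫_{(ℂ²)ⁿ} conj(C_[k](w₁,…,wₙ)) · C_[k'](w₁,…,wₙ) ∏_{i=1}^n dμ(w_i) ) · C_[k](z₁,…,zₙ) = C_[k'](z₁,…,zₙ). (This is the resolution of the identity on the space of n-valent SU(2) intertwiners in the discrete-coherent basis: the states |[k]⟩ with weights 1/‖[k]‖² form a tight frame on their span.) -/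
/-!
STATEMENT 1: resolution of the identity on the space of n-valent SU(2)
intertwiners in the discrete-coherent basis (tight frame property).
-/

noncomputable section

open MeasureTheory

/-- Density of the Gaussian measure dμ(z) = π⁻²·e^(−⟨z|z⟩) dz on ℂ². -/
def gdens (z : Spinor) : ℝ :=
  Real.pi⁻¹ ^ 2 * Real.exp (-(Complex.normSq (z 0) + Complex.normSq (z 1)))

/-- The set of ordered pairs i < j. -/
def pairs (n : ℕ) : Finset (Fin n × Fin n) :=
  Finset.univ.filter fun p => p.1 < p.2

/-- Membership in K_d: symmetric, zero diagonal, with row sums d. -/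
def IsK (n : ℕ) (d : Fin n → ℕ) (k : Fin n → Fin n → ℕ) : Prop :=
  (∀ i j, k i j = k j i) ∧ (∀ i, k i i = 0) ∧
    ∀ i, (∑ j ∈ Finset.univ.erase i, k i j) = d i

/-- The discrete-coherent intertwiner `C_[k](z) = ∏_{i<j} [z_i|z_j⟩^{k_ij}/(k_ij)!`. -/
def Cfun (n : ℕ) (k : Fin n → Fin n → ℕ) (z : Fin n → Spinor) : ℂ :=
  ∏ p ∈ pairs n, bra (z p.1) (z p.2) ^ k p.1 p.2 / (Nat.factorial (k p.1 p.2) : ℂ)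

/-- `J = Σ_{i<j} k_ij`. -/
def Jtot (n : ℕ) (k : Fin n → Fin n → ℕ) : ℕ := ∑ p ∈ pairs n, k p.1 p.2

/-- The squared norm `‖[k]‖² = (J+1)!/∏_{i<j} (k_ij)!`. -/
def normKsq (n : ℕ) (k : Fin n → Fin n → ℕ) : ℂ :=
  (Nat.factorial (Jtot n k + 1) : ℂ) /
    ∏ p ∈ pairs n, (Nat.factorial (k p.1 p.2) : ℂ)


lemma integral_conj_pow_mul_pow (m n : ℕ) :
    ∫ z : ℂ, starRingEnd ℂ z ^ m * z ^ n * (Real.pi⁻¹ * Real.exp (-Complex.normSq z) : ℝ) =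
      if m = n then (m.factorial : ℂ) else 0 := by
  split_ifs with h
  · subst h
    have h1 := Complex.integral_rpow_mul_exp_neg_rpow (p := 2) (q := 2 * m) (by norm_num)
      (by have : (0 : ℝ) ≤ m := by positivity
          linarith)
    have h2 : ∀ z : ℂ, starRingEnd ℂ z ^ m * z ^ m * (Real.pi⁻¹ * Real.exp (-Complex.normSq z) : ℝ)
        = ((Real.pi⁻¹ * (‖z‖ ^ (2 * m : ℝ) * Real.exp (-‖z‖ ^ (2 : ℝ))) : ℝ) : ℂ) := by
      intro z
      have e : ‖z‖ ^ (2 * m : ℝ) = Complex.normSq z ^ m := by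
        rw [Complex.normSq_eq_norm_sq, ← pow_mul]
        exact_mod_cast Real.rpow_natCast ‖z‖ (2 * m)
      have e2 : ‖z‖ ^ (2 : ℝ) = Complex.normSq z := by
        rw [Complex.normSq_eq_norm_sq]
        exact_mod_cast Real.rpow_natCast ‖z‖ 2
      rw [e, e2, ← mul_pow, mul_comm (starRingEnd ℂ z), Complex.mul_conj]
      push_cast
      ring
    simp_rw [h2]
    rw [integral_complex_ofReal, integral_const_mul, h1,
      show ((2 * m + 2 : ℝ) / 2) = m + 1 by ring, Real.Gamma_nat_eq_factorial]
    have := Real.pi_ne_zero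
    push_cast
    field_simp
  · set f : ℂ → ℂ := fun z =>
      starRingEnd ℂ z ^ m * z ^ n * (Real.pi⁻¹ * Real.exp (-Complex.normSq z) : ℝ) with hf
    have key : ∀ c : Circle, ∫ z, f z = (starRingEnd ℂ (c : ℂ) ^ m * (c : ℂ) ^ n) * ∫ z, f z := by
      intro c
      rw [← integral_const_mul,
        ← (rotation c).measurePreserving.integral_comp
          (rotation c).toMeasurableEquiv.measurableEmbedding f]
      congr 1
      ext z
      simp only [hf, rotation_apply, map_mul, Circle.normSq_coe, one_mul]
      ring
    obtain ⟨c, hc⟩ : ∃ c : Circle, starRingEnd ℂ (c : ℂ) ^ m * (c : ℂ) ^ n ≠ 1 := by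
      refine ⟨Circle.exp 1, fun hc => h ?_⟩
      rw [Circle.coe_exp, ← Complex.exp_conj, ← Complex.exp_nat_mul, ← Complex.exp_nat_mul,
        ← Complex.exp_add, Complex.exp_eq_one_iff] at hc
      obtain ⟨l, hl⟩ := hc
      have h3 := congrArg Complex.im hl
      simp at h3
      by_contra hmn
      have hl0 : l ≠ 0 := by
        rintro rfl
        simp at h3
        exact hmn (by exact_mod_cast (by linarith : (m : ℝ) = n))
      refine irrational_pi ⟨((n : ℚ) - m) / (2 * l), ?_⟩
      have : (l : ℝ) ≠ 0 := by exact_mod_cast hl0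
      push_cast
      field_simp
      linarith
    have := key c
    by_contra h0
    exact hc (mul_right_cancel₀ h0 (by rw [one_mul]; exact this.symm))

lemma integrable_conj_pow_mul_pow (m n : ℕ) :
    Integrable fun z : ℂ =>
      starRingEnd ℂ z ^ m * z ^ n * (Real.pi⁻¹ * Real.exp (-Complex.normSq z) : ℝ) := by
  have h1 := Complex.integral_rpow_mul_exp_neg_rpow (p := 2) (q := (m + n : ℕ)) (by norm_num)
    (by have : (0 : ℝ) ≤ (m + n : ℕ) := by positivity
        linarith)
  have h2 : Integrable fun z : ℂ => ‖z‖ ^ ((m + n : ℕ) : ℝ) * Real.exp (-‖z‖ ^ (2 : ℝ)) := by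
    apply Integrable.of_integral_ne_zero
    rw [h1]
    have := Real.Gamma_pos_of_pos (show (0 : ℝ) < (((m + n : ℕ) : ℝ) + 2) / 2 by positivity)
    positivity
  refine (h2.const_mul Real.pi⁻¹).mono' (by fun_prop) (ae_of_all _ fun z => le_of_eq ?_)
  have e2 : ‖z‖ ^ (2 : ℝ) = Complex.normSq z := by
    rw [Complex.normSq_eq_norm_sq]
    exact_mod_cast Real.rpow_natCast ‖z‖ 2
  rw [e2, Real.rpow_natCast, norm_mul, norm_mul, norm_pow, norm_pow, Complex.norm_conj,
    Complex.norm_real, Real.norm_of_nonneg (by positivity), pow_add]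
  ring

open MvPolynomial

/-- Polynomials in the spinor components, the variable `(i, a)` standing for `(z i) a`. -/
abbrev SpinorPoly (n : ℕ) := MvPolynomial (Fin n × Fin 2) ℂ

/-- The bracket as a polynomial. -/
def braPoly {n : ℕ} (p : Fin n × Fin n) : SpinorPoly n :=
  X (p.1, 0) * X (p.2, 1) - X (p.1, 1) * X (p.2, 0)

/-- The constant-coefficient operator dual to multiplication by the bracket. -/
def braDual {n : ℕ} (p : Fin n × Fin n) (q : SpinorPoly n) : SpinorPoly n :=
  pderiv (p.1, 0) (pderiv (p.2, 1) q) - pderiv (p.1, 1) (pderiv (p.2, 0) q)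

/-- The generators `∑ i, z_{i,u} ∂_{i,v}` of the diagonal `GL(2)` action. -/
def glGen (n : ℕ) (u v : Fin 2) : Derivation ℂ (SpinorPoly n) (SpinorPoly n) :=
  ∑ i, (X (i, u) : SpinorPoly n) • pderiv (i, v)

/-- The Euler operator of the `i`-th spinor. -/
def spinorEuler {n : ℕ} (i : Fin n) : Derivation ℂ (SpinorPoly n) (SpinorPoly n) :=
  ∑ a, (X (i, a) : SpinorPoly n) • pderiv (i, a)

/-- The monomial `∏_{i<j} [z_i|z_j⟩^{k_ij}` in the brackets, as a polynomial. -/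
def braMonomial {n : ℕ} (k : Fin n × Fin n → ℕ) : SpinorPoly n :=
  ∏ p ∈ pairs n, braPoly p ^ k p

/-- `SU(2)`-invariant polynomials of degree `2 * J`, characterized infinitesimally. -/
structure IsInvariantOfDegree {n : ℕ} (J : ℕ) (q : SpinorPoly n) : Prop where
  homogeneous : q.IsHomogeneous (2 * J)
  gl_diag : ∀ u, glGen n u u q = (J : ℂ) • q
  gl_offDiag : ∀ u v, u ≠ v → glGen n u v q = 0

lemma glGen_apply {n : ℕ} (u v : Fin 2) (q : SpinorPoly n) :
    glGen n u v q = ∑ i, X (i, u) * pderiv (i, v) q := by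
  have sum_apply (s : Finset (Fin n)) :
      (∑ i ∈ s, (X (i, u) : SpinorPoly n) • pderiv (R := ℂ) (i, v)) q =
        ∑ i ∈ s, X (i, u) * pderiv (i, v) q := by
    induction s using Finset.induction_on with
    | empty => simp
    | insert a s ha ih =>
      rw [Finset.sum_insert ha, Finset.sum_insert ha, Derivation.add_apply, ih,
        Derivation.smul_apply, smul_eq_mul]
  exact sum_apply Finset.univ

lemma glGen_X {n : ℕ} (u v t : Fin 2) (j : Fin n) :
    glGen n u v (X (j, t)) = if v = t then X (j, u) else 0 := by
  rw [glGen_apply, Finset.sum_eq_single j]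
  · by_cases h : v = t <;> simp [h]
  · intro i _ hi
    simp [Ne.symm hi]
  · simp

lemma spinorEuler_apply {n : ℕ} (i : Fin n) (q : SpinorPoly n) :
    spinorEuler i q = ∑ a, X (i, a) * pderiv (i, a) q := by
  simp [spinorEuler, Fin.sum_univ_two]

lemma pderiv_comm_apply {σ R : Type*} [CommRing R] (a b : σ) (q : MvPolynomial σ R) :
    pderiv a (pderiv b q) = pderiv b (pderiv a q) := by
  classical
  have h : ⁅pderiv (R := R) a, pderiv (R := R) b⁆ = 0 := by
    apply derivation_ext
    intro i
    simp only [Derivation.commutator_apply, pderiv_X, Derivation.coe_zero, Pi.zero_apply]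
    by_cases h1 : b = i <;> by_cases h2 : a = i <;> simp [h1, h2]
  have := congrArg (fun D => D q) h
  simpa [Derivation.commutator_apply, sub_eq_zero] using this

lemma glGen_pderiv {n : ℕ} (u v t : Fin 2) (i : Fin n) (q : SpinorPoly n) :
    glGen n u v (pderiv (i, t) q) =
      pderiv (i, t) (glGen n u v q) - if t = u then pderiv (i, v) q else 0 := by
  simp only [glGen_apply, map_sum, pderiv_mul, pderiv_X, Finset.sum_add_distrib]
  have : ∑ x, Pi.single (M := fun _ => SpinorPoly n) (i, t) (1 : SpinorPoly n) (x, u) *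
      pderiv (x, v) q = if t = u then pderiv (i, v) q else 0 := by
    rw [Finset.sum_eq_single i]
    · rcases eq_or_ne t u with h | h
      · simp [h]
      · simp [h, h.symm]
    · intro j _ hj
      simp [hj]
    · simp
  rw [this, add_sub_cancel_left]
  simp only [pderiv_comm_apply (i, t)]

lemma IsInvariantOfDegree.braDual {n J : ℕ} {q : SpinorPoly n} (h : IsInvariantOfDegree (J + 1) q)
    (p : Fin n × Fin n) : IsInvariantOfDegree J (braDual p q) := by
  have h00 := h.gl_diag 0
  have h11 := h.gl_diag 1
  have h01 := h.gl_offDiag 0 1 (by decide)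
  have h10 := h.gl_offDiag 1 0 (by decide)
  refine ⟨?_, ?_, ?_⟩
  · have := fun a b => (h.homogeneous.pderiv (i := a)).pderiv (i := b)
    simp only [show 2 * (J + 1) - 1 - 1 = 2 * J by omega] at this
    exact (this _ _).sub (this _ _)
  · intro u
    fin_cases u <;>
    · simp [_root_.braDual, glGen_pderiv, h00, h11, add_smul]
      module
  · intro u v huv
    fin_cases u <;> fin_cases v <;> simp at huv <;>
    · simp [_root_.braDual, glGen_pderiv, h01, h10]
      try rw [pderiv_comm_apply, sub_self]

lemma sum_sum_eq_sum_pairs {M : Type*} [AddCommMonoid M] (n : ℕ) (f : Fin n → Fin n → M)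
    (hs : ∀ i j, f i j = f j i) (hd : ∀ i, f i i = 0) :
    ∑ i, ∑ j, f i j = 2 • ∑ p ∈ pairs n, f p.1 p.2 := by
  have hlt : ∑ p ∈ pairs n, f p.1 p.2 = ∑ i, ∑ j, if i < j then f i j else 0 := by
    rw [pairs, Finset.sum_filter, Fintype.sum_prod_type]
  have hgt : ∑ p ∈ pairs n, f p.1 p.2 = ∑ i, ∑ j, if j < i then f i j else 0 := by
    rw [hlt, Finset.sum_comm]
    simp only [hs]
  rw [two_nsmul]
  nth_rw 1 [hlt]
  rw [hgt]
  simp only [← Finset.sum_add_distrib]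
  refine Finset.sum_congr rfl fun i _ => Finset.sum_congr rfl fun j _ => ?_
  rcases lt_trichotomy i j with h | h | h
  · simp [h, h.not_gt]
  · simp [h, hd]
  · simp [h, h.not_gt]

lemma glGen_glGen_apply {n : ℕ} (u v s t : Fin 2) (q : SpinorPoly n) :
    glGen n u v (glGen n s t q) = (∑ i, ∑ j, X (i, u) * X (j, s) * pderiv (i, v) (pderiv (j, t) q))
      + if v = s then glGen n u t q else 0 := by
  have hterm (j : Fin n) : glGen n u v (X (j, s) * pderiv (j, t) q) =
      (∑ i, X (i, u) * X (j, s) * pderiv (i, v) (pderiv (j, t) q)) +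
        if v = s then X (j, u) * pderiv (j, t) q else 0 := by
    have h := (glGen n u v).leibniz (X (j, s)) (pderiv (j, t) q)
    rw [glGen_X, smul_eq_mul, smul_eq_mul] at h
    rw [h, glGen_apply u v, Finset.mul_sum, mul_ite, mul_zero, mul_comm _ (X (j, u))]
    refine congrArg (· + _) (Finset.sum_congr rfl fun i _ => ?_)
    rw [← mul_assoc, mul_comm (X (j, s))]
  rw [glGen_apply s t, map_sum, Finset.sum_congr rfl fun j _ => hterm j, Finset.sum_add_distrib,
    Finset.sum_comm]
  congr 1
  split_ifs with h
  · rw [glGen_apply]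
  · exact Finset.sum_const_zero

/-- Capelli's identity for `2 × 2` matrices, applied to an invariant polynomial. -/
lemma IsInvariantOfDegree.sum_bra_mul_braDual {n J : ℕ} {q : SpinorPoly n}
    (h : IsInvariantOfDegree J q) :
    ∑ p ∈ pairs n, braPoly p * _root_.braDual p q = ((J : ℂ) * (J + 1)) • q := by
  have key := sum_sum_eq_sum_pairs n (fun i j => braPoly (i, j) * _root_.braDual (i, j) q)
    (fun i j => by
      simp only [braPoly, _root_.braDual]
      rw [pderiv_comm_apply (j, 0) (i, 1), pderiv_comm_apply (j, 1) (i, 0)]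
      ring)
    (fun i => by simp [braPoly, _root_.braDual, mul_comm])
  have e1 := glGen_glGen_apply 0 0 1 1 q
  have e2 := glGen_glGen_apply 0 1 1 0 q
  have e3 := glGen_glGen_apply 1 1 0 0 q
  have e4 := glGen_glGen_apply 1 0 0 1 q
  rw [h.gl_diag, Derivation.map_smul, h.gl_diag] at e1 e3
  rw [h.gl_offDiag _ _ (by decide), map_zero] at e2 e4
  rw [if_pos rfl, h.gl_diag] at e2 e4
  simp only [reduceIte, Fin.isValue, zero_ne_one, one_ne_zero, add_zero] at e1 e2 e3 e4
  have expand : ∑ i, ∑ j, braPoly (i, j) * _root_.braDual (i, j) q =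
      (∑ i, ∑ j, X (i, 0) * X (j, 1) * pderiv (i, 0) (pderiv (j, 1) q))
      - (∑ i, ∑ j, X (i, 0) * X (j, 1) * pderiv (i, 1) (pderiv (j, 0) q))
      + (∑ i, ∑ j, X (i, 1) * X (j, 0) * pderiv (i, 1) (pderiv (j, 0) q))
      - (∑ i, ∑ j, X (i, 1) * X (j, 0) * pderiv (i, 0) (pderiv (j, 1) q)) := by
    simp only [← Finset.sum_add_distrib, ← Finset.sum_sub_distrib]
    refine Finset.sum_congr rfl fun i _ => Finset.sum_congr rfl fun j _ => ?_
    simp only [braPoly, _root_.braDual]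
    ring
  rw [expand, ← e1, ← e3] at key
  have e2' := eq_neg_of_add_eq_zero_left e2.symm
  have e4' := eq_neg_of_add_eq_zero_left e4.symm
  rw [e2', e4'] at key
  have h2 : (2 : ℂ) ≠ 0 := two_ne_zero
  apply smul_right_injective _ h2
  simp only
  have : (2 : ℂ) • ∑ p ∈ pairs n, braPoly p * _root_.braDual p q
      = 2 • ∑ p ∈ pairs n, braPoly p * _root_.braDual p q := by module
  rw [this, ← key]
  module

lemma derivation_braMonomial {n : ℕ} (D : Derivation ℂ (SpinorPoly n) (SpinorPoly n))
    (c : Fin n × Fin n → ℂ) (k : Fin n × Fin n → ℕ)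
    (hD : ∀ p ∈ pairs n, D (braPoly p) = c p • braPoly p) :
    D (braMonomial k) = (∑ p ∈ pairs n, k p * c p) • braMonomial k := by
  have gen : ∀ s ⊆ pairs n, D (∏ p ∈ s, braPoly p ^ k p) =
      (∑ p ∈ s, k p * c p) • ∏ p ∈ s, braPoly p ^ k p := by
    intro s
    induction s using Finset.induction_on with
    | empty => simp
    | insert a s ha ih =>
      intro hs
      rw [Finset.prod_insert ha, Finset.sum_insert ha, Derivation.leibniz,
        ih ((Finset.subset_insert _ _).trans hs), Derivation.leibniz_pow,
        hD a (hs (Finset.mem_insert_self _ _))]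
      rcases hk : k a with _ | m
      · simp
      · simp only [Nat.add_sub_cancel, smul_eq_mul, nsmul_eq_mul, MvPolynomial.smul_eq_C_mul,
          map_add, map_mul, map_natCast, pow_succ]
        ring
  exact gen _ subset_rfl

lemma isInvariantOfDegree_braMonomial {n : ℕ} (k : Fin n × Fin n → ℕ) :
    IsInvariantOfDegree (∑ p ∈ pairs n, k p) (braMonomial k) := by
  have hg (u v : Fin 2) (p : Fin n × Fin n) :
      glGen n u v (braPoly p) = if u = v then braPoly p else 0 := by
    simp only [braPoly, map_sub, Derivation.leibniz, glGen_X, smul_eq_mul]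
    fin_cases u <;> fin_cases v <;> simp <;> ring
  refine ⟨?_, fun u => ?_, fun u v huv => ?_⟩
  · rw [Finset.mul_sum]
    refine IsHomogeneous.prod _ _ _ fun p _ => IsHomogeneous.pow ?_ _
    exact ((isHomogeneous_X _ _).mul (isHomogeneous_X _ _)).sub
      ((isHomogeneous_X _ _).mul (isHomogeneous_X _ _))
  · rw [derivation_braMonomial _ (fun _ => 1) k (by simp [hg])]
    simp
  · rw [derivation_braMonomial _ (fun _ => 0) k (by simp [hg, huv])]
    simp

lemma spinorEuler_braMonomial {n : ℕ} (i : Fin n) (k : Fin n × Fin n → ℕ) :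
    spinorEuler i (braMonomial k) =
      (∑ p ∈ pairs n, (k p : ℂ) * ((if p.1 = i then 1 else 0) + if p.2 = i then 1 else 0))
        • braMonomial k := by
  refine derivation_braMonomial _ _ k fun p _ => ?_
  have hX (j : Fin n) (t : Fin 2) :
      spinorEuler i (X (j, t)) = if j = i then X (j, t) else 0 := by
    rw [spinorEuler_apply]
    by_cases h : j = i
    · subst h
      fin_cases t <;> simp [Pi.single_apply]
    · simp [h]
  simp only [braPoly, map_sub, Derivation.leibniz, hX, smul_eq_mul]
  split_ifs <;> simp [smul_eq_C_mul] <;> ring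

/-- The integrand of the Gaussian pairing of two polynomials, with the first one evaluated at the
conjugate point. -/
def fischerIntegrand {n : ℕ} (p q : SpinorPoly n) (w : Fin n → Spinor) : ℂ :=
  eval (fun x => starRingEnd ℂ (w x.1 x.2)) p * eval (fun x => w x.1 x.2) q *
    ∏ i, (gdens (w i) : ℂ)

lemma fischerIntegrand_monomial {n : ℕ} (α β : Fin n × Fin 2 →₀ ℕ) (a b : ℂ)
    (w : Fin n → Spinor) :
    fischerIntegrand (monomial α a) (monomial β b) w =
      a * b * ∏ i, ∏ t, (starRingEnd ℂ (w i t) ^ α (i, t) * w i t ^ β (i, t) *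
        (Real.pi⁻¹ * Real.exp (-Complex.normSq (w i t)) : ℝ)) := by
  have hg (z : Spinor) :
      (gdens z : ℂ) = ∏ t, ((Real.pi⁻¹ * Real.exp (-Complex.normSq (z t)) : ℝ) : ℂ) := by
    rw [Fin.prod_univ_two, gdens, neg_add, Real.exp_add]
    push_cast
    ring
  simp only [fischerIntegrand, eval_monomial, hg, Finset.prod_mul_distrib]
  rw [Finsupp.prod_fintype _ _ (by simp), Finsupp.prod_fintype _ _ (by simp),
    Fintype.prod_prod_type, Fintype.prod_prod_type]
  ring

lemma integrable_fischerIntegrand {n : ℕ} (p q : SpinorPoly n) :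
    Integrable (fischerIntegrand p q) := by
  induction p using MvPolynomial.induction_on' with
  | add p₁ p₂ h₁ h₂ =>
    refine (h₁.add h₂).congr (ae_of_all _ fun w => ?_)
    simp only [fischerIntegrand, Pi.add_apply, map_add]
    ring
  | monomial α a =>
    induction q using MvPolynomial.induction_on' with
    | add q₁ q₂ h₁ h₂ =>
      refine (h₁.add h₂).congr (ae_of_all _ fun w => ?_)
      simp only [fischerIntegrand, Pi.add_apply, map_add]
      ring
    | monomial β b =>
      rw [show fischerIntegrand (monomial α a) (monomial β b) = _ from
        funext (fischerIntegrand_monomial α β a b)]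
      refine Integrable.const_mul ?_ _
      refine Integrable.fintype_prod (E := Spinor) (f := fun i z => ∏ t,
        (starRingEnd ℂ (z t) ^ α (i, t) * z t ^ β (i, t) *
          (Real.pi⁻¹ * Real.exp (-Complex.normSq (z t)) : ℝ))) fun i => ?_
      exact Integrable.fintype_prod (E := ℂ) (f := fun t z => (starRingEnd ℂ z ^ α (i, t) *
        z ^ β (i, t) * (Real.pi⁻¹ * Real.exp (-Complex.normSq z) : ℝ)))
        fun t => integrable_conj_pow_mul_pow _ _

/-- The Gaussian (Segal–Bargmann, or Fischer) pairing of polynomials, made bilinear by evaluating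
the first one at the conjugate point. -/
def fischer (n : ℕ) : SpinorPoly n →ₗ[ℂ] SpinorPoly n →ₗ[ℂ] ℂ :=
  LinearMap.mk₂ ℂ (fun p q => ∫ w, fischerIntegrand p q w)
    (fun p₁ p₂ q => by
      rw [← integral_add (integrable_fischerIntegrand _ _) (integrable_fischerIntegrand _ _)]
      simp only [fischerIntegrand, map_add, add_mul])
    (fun c p q => by
      rw [smul_eq_mul, ← integral_const_mul]
      simp only [fischerIntegrand, smul_eval, mul_assoc])
    (fun p q₁ q₂ => by
      rw [← integral_add (integrable_fischerIntegrand _ _) (integrable_fischerIntegrand _ _)]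
      simp only [fischerIntegrand, map_add, add_mul, mul_add])
    (fun c p q => by
      rw [smul_eq_mul, ← integral_const_mul]
      simp only [fischerIntegrand, smul_eval]
      exact integral_congr_ae (ae_of_all _ fun w => by ring))

lemma fischer_apply {n : ℕ} (p q : SpinorPoly n) :
    fischer n p q = ∫ w, fischerIntegrand p q w := rfl

lemma fischer_monomial {n : ℕ} (α β : Fin n × Fin 2 →₀ ℕ) (a b : ℂ) :
    fischer n (monomial α a) (monomial β b) =
      a * b * ∏ x, if α x = β x then ((α x).factorial : ℂ) else 0 := by
  rw [fischer_apply]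
  simp_rw [fischerIntegrand_monomial]
  rw [integral_const_mul, Fintype.prod_prod_type]
  congr 1
  rw [integral_fintype_prod_volume_eq_prod (E := fun _ : Fin n => Spinor) (fun i z => ∏ t,
    (starRingEnd ℂ (z t) ^ α (i, t) * z t ^ β (i, t) *
      ((Real.pi⁻¹ * Real.exp (-Complex.normSq (z t)) : ℝ) : ℂ)))]
  refine Finset.prod_congr rfl fun i _ => ?_
  rw [integral_fintype_prod_volume_eq_prod (E := fun _ : Fin 2 => ℂ) (fun t z =>
    (starRingEnd ℂ z ^ α (i, t) * z ^ β (i, t) *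
      ((Real.pi⁻¹ * Real.exp (-Complex.normSq z) : ℝ) : ℂ)))]
  exact Finset.prod_congr rfl fun t _ => integral_conj_pow_mul_pow _ _

lemma fischer_comm {n : ℕ} (p q : SpinorPoly n) : fischer n p q = fischer n q p := by
  induction p using MvPolynomial.induction_on' with
  | add p₁ p₂ h₁ h₂ => simp only [map_add, LinearMap.add_apply, h₁, h₂]
  | monomial α a =>
    induction q using MvPolynomial.induction_on' with
    | add q₁ q₂ h₁ h₂ => simp only [map_add, LinearMap.add_apply, h₁, h₂]
    | monomial β b =>
      rw [fischer_monomial, fischer_monomial, mul_comm a b]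
      refine congrArg _ (Finset.prod_congr rfl fun x _ => ?_)
      by_cases h : α x = β x
      · rw [h]
      · rw [if_neg h, if_neg (Ne.symm h)]

lemma fischer_X_mul {n : ℕ} (x : Fin n × Fin 2) (p q : SpinorPoly n) :
    fischer n (X x * p) q = fischer n p (pderiv x q) := by
  induction p using MvPolynomial.induction_on' with
  | add p₁ p₂ h₁ h₂ => simp only [mul_add, map_add, LinearMap.add_apply, h₁, h₂]
  | monomial α a =>
    induction q using MvPolynomial.induction_on' with
    | add q₁ q₂ h₁ h₂ => simp only [map_add, h₁, h₂]
    | monomial β b =>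
      rw [pderiv_monomial, X, monomial_mul, fischer_monomial, fischer_monomial, one_mul,
        Fintype.prod_eq_mul_prod_compl x, Fintype.prod_eq_mul_prod_compl x]
      have hne : ∀ y ∈ ({x}ᶜ : Finset (Fin n × Fin 2)), y ≠ x := by simp
      have h₁ : ∏ y ∈ {x}ᶜ, (if (Finsupp.single x 1 + α : Fin n × Fin 2 →₀ ℕ) y = β y
          then (((Finsupp.single x 1 + α : Fin n × Fin 2 →₀ ℕ) y).factorial : ℂ) else 0) =
          ∏ y ∈ {x}ᶜ, if α y = β y then ((α y).factorial : ℂ) else 0 :=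
        Finset.prod_congr rfl fun y hy => by
          rw [Finsupp.add_apply, Finsupp.single_eq_of_ne (hne y hy), zero_add]
      have h₂ : ∏ y ∈ {x}ᶜ, (if α y = (β - Finsupp.single x 1 : Fin n × Fin 2 →₀ ℕ) y
          then ((α y).factorial : ℂ) else 0) =
          ∏ y ∈ {x}ᶜ, if α y = β y then ((α y).factorial : ℂ) else 0 :=
        Finset.prod_congr rfl fun y hy => by
          rw [Finsupp.tsub_apply, Finsupp.single_eq_of_ne (hne y hy), Nat.sub_zero]
      rw [h₁, h₂]
      simp only [Finsupp.add_apply, Finsupp.tsub_apply, Finsupp.single_eq_same]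
      rcases hb : β x with _ | m
      · simp
      · by_cases h : α x = m
        · simp only [h, add_comm 1 m, Nat.add_sub_cancel, if_true, Nat.factorial_succ]
          push_cast
          ring
        · rw [if_neg (by omega), if_neg (by omega)]
          ring

lemma fischer_braPoly_mul {n : ℕ} (x : Fin n × Fin n) (p q : SpinorPoly n) :
    fischer n (braPoly x * p) q = fischer n p (braDual x q) := by
  simp only [braPoly, braDual, sub_mul, mul_assoc, map_sub, LinearMap.sub_apply, fischer_X_mul]
  rw [pderiv_comm_apply (x.2, 1), pderiv_comm_apply (x.2, 0)]

lemma fischer_spinorEuler {n : ℕ} (i : Fin n) (p q : SpinorPoly n) :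
    fischer n (spinorEuler i p) q = fischer n p (spinorEuler i q) := by
  rw [fischer_comm p]
  simp only [spinorEuler_apply, map_sum, LinearMap.sum_apply, fischer_X_mul]
  exact Finset.sum_congr rfl fun t _ => fischer_comm _ _

/-- The reproducing property of `(∑_{i<j} [z_i|z_j⟩ [w_i|w_j⟩)^J` on invariant polynomials. -/
lemma IsInvariantOfDegree.fischer_kernel {n J : ℕ} {q : SpinorPoly n}
    (h : IsInvariantOfDegree J q) (z : Fin n × Fin 2 → ℂ) :
    fischer n ((∑ p ∈ pairs n, C (eval z (braPoly p)) * braPoly p) ^ J) q =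
      J.factorial * (J + 1).factorial * eval z q := by
  induction J generalizing q with
  | zero =>
    obtain ⟨c, rfl⟩ : ∃ c, q = C c :=
      ⟨_, totalDegree_eq_zero_iff_eq_C.mp
        ((totalDegree_zero_iff_isHomogeneous _).mpr h.homogeneous)⟩
    have := fischer_monomial (n := n) 0 0 1 c
    simpa using this
  | succ J ih =>
    set K : SpinorPoly n := ∑ p ∈ pairs n, C (eval z (braPoly p)) * braPoly p
    have hK : K ^ (J + 1) = ∑ p ∈ pairs n, eval z (braPoly p) • (braPoly p * K ^ J) := by
      rw [pow_succ', Finset.sum_mul]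
      simp only [smul_eq_C_mul, mul_assoc]
    have hΩ := congrArg (eval z) h.sum_bra_mul_braDual
    rw [map_sum, smul_eval] at hΩ
    simp only [map_mul] at hΩ
    rw [hK, map_sum, LinearMap.sum_apply]
    simp only [map_smul, LinearMap.smul_apply, fischer_braPoly_mul, ih (h.braDual _), smul_eq_mul]
    rw [Finset.sum_congr rfl fun p _ => mul_left_comm _ _ _, ← Finset.mul_sum, hΩ,
      Nat.factorial_succ (J + 1), Nat.factorial_succ J]
    push_cast
    ring

/-- The degree in the `i`-th spinor of the bracket monomial with exponents `k`. -/
def rowDegree {n : ℕ} (k : Fin n × Fin n → ℕ) (i : Fin n) : ℕ :=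
  ∑ p ∈ pairs n, k p * ((if p.1 = i then 1 else 0) + if p.2 = i then 1 else 0)

lemma rowDegree_eq_of_fischer_ne_zero {n : ℕ} {k l : Fin n × Fin n → ℕ}
    (h : fischer n (braMonomial k) (braMonomial l) ≠ 0) : rowDegree k = rowDegree l := by
  funext i
  have hE (m : Fin n × Fin n → ℕ) :
      spinorEuler i (braMonomial m) = (rowDegree m i : ℂ) • braMonomial m := by
    rw [spinorEuler_braMonomial, rowDegree]
    push_cast
    rfl
  have := fischer_spinorEuler i (braMonomial k) (braMonomial l)
  rw [hE, hE, map_smul, map_smul, LinearMap.smul_apply, smul_eq_mul, smul_eq_mul] at this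
  exact_mod_cast mul_right_cancel₀ h this

lemma rowDegree_eq_sum {n : ℕ} (k : Fin n → Fin n → ℕ) (hs : ∀ i j, k i j = k j i)
    (hd : ∀ i, k i i = 0) (i : Fin n) :
    rowDegree (fun p => k p.1 p.2) i = ∑ j ∈ Finset.univ.erase i, k i j := by
  have h := sum_sum_eq_sum_pairs n
    (fun a b => k a b * ((if a = i then 1 else 0) + if b = i then 1 else 0))
    (fun a b => by rw [hs a b, add_comm]) (fun a => by simp [hd])
  have e : ∑ a, ∑ b, k a b * ((if a = i then 1 else 0) + if b = i then 1 else 0) =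
      2 * ∑ j, k i j := by
    simp only [mul_add, Finset.sum_add_distrib, mul_ite, mul_one, mul_zero, Finset.sum_ite_eq',
      Finset.mem_univ, if_true]
    rw [Finset.sum_comm]
    simp [hs i, two_mul]
  rw [e, smul_eq_mul] at h
  have h2 : rowDegree (fun p => k p.1 p.2) i = ∑ j, k i j :=
    (Nat.eq_of_mul_eq_mul_left two_pos h).symm
  rw [h2, ← Finset.add_sum_erase _ _ (Finset.mem_univ i), hd, zero_add]

lemma rowDegree_congr {n : ℕ} {k l : Fin n × Fin n → ℕ} (h : ∀ p ∈ pairs n, k p = l p) :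
    rowDegree k = rowDegree l :=
  funext fun _ => Finset.sum_congr rfl fun p hp => by rw [h p hp]

lemma braMonomial_congr {n : ℕ} {k l : Fin n × Fin n → ℕ} (h : ∀ p ∈ pairs n, k p = l p) :
    braMonomial k = braMonomial l :=
  Finset.prod_congr rfl fun p hp => by rw [h p hp]

lemma IsK.two_mul_Jtot {n : ℕ} {d : Fin n → ℕ} {k : Fin n → Fin n → ℕ} (h : IsK n d k) :
    2 * Jtot n k = ∑ i, d i := by
  obtain ⟨hs, hd, hr⟩ := h
  rw [Jtot, ← smul_eq_mul, ← sum_sum_eq_sum_pairs n k hs hd]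
  refine Finset.sum_congr rfl fun i _ => ?_
  rw [← hr, ← Finset.add_sum_erase _ _ (Finset.mem_univ i), hd, zero_add]

lemma Cfun_eq_eval {n : ℕ} (k : Fin n → Fin n → ℕ) (w : Fin n → Spinor) :
    Cfun n k w = eval (fun x => w x.1 x.2) (braMonomial fun p => k p.1 p.2) /
      ∏ p ∈ pairs n, (Nat.factorial (k p.1 p.2) : ℂ) := by
  simp [Cfun, braMonomial, Finset.prod_div_distrib, braPoly, bra]

lemma integral_conj_Cfun_mul_Cfun {n : ℕ} (k l : Fin n → Fin n → ℕ) :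
    ∫ w : Fin n → Spinor, starRingEnd ℂ (Cfun n k w) * Cfun n l w * ∏ i, (gdens (w i) : ℂ) =
      ((∏ p ∈ pairs n, (Nat.factorial (k p.1 p.2) : ℂ)) *
        ∏ p ∈ pairs n, (Nat.factorial (l p.1 p.2) : ℂ))⁻¹ *
      fischer n (braMonomial fun p => k p.1 p.2) (braMonomial fun p => l p.1 p.2) := by
  rw [fischer_apply, ← integral_const_mul]
  refine integral_congr_ae (ae_of_all _ fun w => ?_)
  have hc : starRingEnd ℂ (Cfun n k w) = Cfun n k fun i t => starRingEnd ℂ (w i t) := by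
    simp [Cfun, bra]
  simp only [hc]
  simp only [Cfun_eq_eval, fischerIntegrand]
  field_simp

theorem resolution_of_identity
    (n : ℕ) (hn : 1 ≤ n) (d : Fin n → ℕ)
    (k' : Fin n → Fin n → ℕ) (hk' : IsK n d k') (z : Fin n → Spinor) :
    (∑' k : {k : Fin n → Fin n → ℕ // IsK n d k},
        (normKsq n k.1)⁻¹
          * (∫ w : Fin n → Spinor,
              starRingEnd ℂ (Cfun n k.1 w) * Cfun n k' w
                * ∏ i, (gdens (w i) : ℂ))
          * Cfun n k.1 z)
      = Cfun n k' z := by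
  classical
  set J := Jtot n k' with hJ
  set q : SpinorPoly n := braMonomial fun p => k' p.1 p.2 with hq
  set F : ℂ := ∏ p ∈ pairs n, (Nat.factorial (k' p.1 p.2) : ℂ) with hF
  set Z : Fin n × Fin 2 → ℂ := fun x => z x.1 x.2
  have hF0 : F ≠ 0 := Finset.prod_ne_zero_iff.mpr fun p _ =>
    Nat.cast_ne_zero.mpr (Nat.factorial_ne_zero _)
  have hJ0 : (J.factorial : ℂ) ≠ 0 := Nat.cast_ne_zero.mpr (Nat.factorial_ne_zero _)
  have hJ1 : ((J + 1).factorial : ℂ) ≠ 0 := Nat.cast_ne_zero.mpr (Nat.factorial_ne_zero _)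
  let g : (Fin n × Fin n → ℕ) → ℂ := fun κ => if κ ∈ (pairs n).piAntidiag J then
    (J.factorial * (J + 1).factorial * F)⁻¹ * (Nat.multinomial (pairs n) κ *
      (fischer n (braMonomial κ) q * eval Z (braMonomial κ))) else 0
  let trunc : {k : Fin n → Fin n → ℕ // IsK n d k} → Fin n × Fin n → ℕ :=
    fun k p => if p ∈ pairs n then k.1 p.1 p.2 else 0
  have htr (k) : ∀ p ∈ pairs n, trunc k p = k.1 p.1 p.2 := fun p hp => if_pos hp
  have hmem (k) : trunc k ∈ (pairs n).piAntidiag J := by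
    rw [Finset.mem_piAntidiag]
    refine ⟨?_, fun p hp => by by_contra h; exact hp (if_neg h)⟩
    rw [Finset.sum_congr rfl (htr k)]
    have h1 := k.2.two_mul_Jtot
    rw [← hk'.two_mul_Jtot] at h1
    exact Nat.eq_of_mul_eq_mul_left two_pos h1
  have hterm (k : {k : Fin n → Fin n → ℕ // IsK n d k}) : (normKsq n k.1)⁻¹
          * (∫ w : Fin n → Spinor, starRingEnd ℂ (Cfun n k.1 w) * Cfun n k' w
                * ∏ i, (gdens (w i) : ℂ)) * Cfun n k.1 z = g (trunc k) := by
    have hsum : ∑ p ∈ pairs n, trunc k p = J := (Finset.mem_piAntidiag.mp (hmem k)).1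
    have hJk : Jtot n k.1 = J := by rw [← hsum, Finset.sum_congr rfl (htr k), Jtot]
    have hspec := Nat.multinomial_spec (pairs n) (trunc k)
    rw [hsum, Finset.prod_congr rfl fun p hp => by rw [htr k p hp]] at hspec
    have hspec' := congrArg (Nat.cast (R := ℂ)) hspec
    push_cast at hspec'
    have hk0 : ∏ p ∈ pairs n, (Nat.factorial (k.1 p.1 p.2) : ℂ) ≠ 0 :=
      Finset.prod_ne_zero_iff.mpr fun p _ =>
    Nat.cast_ne_zero.mpr (Nat.factorial_ne_zero _)
    rw [integral_conj_Cfun_mul_Cfun]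
    simp only [g, if_pos (hmem k), Cfun_eq_eval, normKsq, hJk,
      braMonomial_congr (htr k)]
    rw [← hspec'] at hJ0 ⊢
    have hm0 := right_ne_zero_of_mul hJ0
    rw [← hF, ← hq]
    field_simp
    rfl
  rw [tsum_congr hterm, Function.Injective.tsum_eq (g := trunc) (f := g),
    tsum_eq_sum (s := (pairs n).piAntidiag J) fun κ hκ => if_neg hκ]
  · have hinv : IsInvariantOfDegree J q := isInvariantOfDegree_braMonomial _
    have hker := hinv.fischer_kernel Z
    rw [Finset.sum_pow_eq_sum_piAntidiag, map_sum, LinearMap.sum_apply] at hker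
    rw [Finset.sum_congr rfl fun κ hκ => if_pos hκ, ← Finset.mul_sum, Cfun_eq_eval, ← hF, ← hq]
    have hsum : ∑ κ ∈ (pairs n).piAntidiag J, ((Nat.multinomial (pairs n) κ : ℂ) *
        (fischer n (braMonomial κ) q * eval Z (braMonomial κ))) =
        J.factorial * (J + 1).factorial * eval Z q := by
      rw [← hker]
      refine Finset.sum_congr rfl fun κ _ => ?_
      have : (Nat.multinomial (pairs n) κ : SpinorPoly n) *
          ∏ p ∈ pairs n, (C (eval Z (braPoly p)) * braPoly p) ^ κ p =
          ((Nat.multinomial (pairs n) κ : ℂ) * eval Z (braMonomial κ)) • braMonomial κ := by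
        simp only [mul_pow, Finset.prod_mul_distrib, braMonomial, smul_eq_C_mul, map_mul, map_prod,
          map_pow, map_natCast, mul_assoc]
      rw [this, map_smul, LinearMap.smul_apply, smul_eq_mul]
      ring
    rw [hsum]
    change _ = eval Z q / F
    field_simp
  · intro k l hkl
    have h1 (i j : Fin n) (hij : i < j) : k.1 i j = l.1 i j := by
      have hp : (i, j) ∈ pairs n := by simpa [pairs] using hij
      rw [← htr k _ hp, hkl, htr l _ hp]
    refine Subtype.ext (funext fun i => funext fun j => ?_)
    rcases lt_trichotomy i j with h | h | h
    · exact h1 i j h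
    · rw [h, k.2.2.1, l.2.2.1]
    · rw [k.2.1, l.2.1, h1 j i h]
  · intro κ hκ
    have hmemκ : κ ∈ (pairs n).piAntidiag J := by
      by_contra h
      exact hκ (if_neg h)
    have hzero : ∀ p, p ∉ pairs n → κ p = 0 := fun p hp => by
      by_contra h
      exact hp ((Finset.mem_piAntidiag.mp hmemκ).2 p h)
    have hfis : fischer n (braMonomial κ) q ≠ 0 := by
      intro h
      apply hκ
      simp only [g, h, zero_mul, mul_zero, ite_self]
    have hrow := rowDegree_eq_of_fischer_ne_zero hfis
    let k : Fin n → Fin n → ℕ := fun i j => κ (i, j) + κ (j, i)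
    have hkκ : ∀ p ∈ pairs n, k p.1 p.2 = κ p := fun p hp => by
      have : (p.2, p.1) ∉ pairs n := by
        simp only [pairs, Finset.mem_filter, Finset.mem_univ, true_and] at hp ⊢
        exact hp.not_gt
      simp [k, hzero _ this]
    have hs : ∀ i j, k i j = k j i := fun i j => add_comm _ _
    have hd : ∀ i, k i i = 0 := fun i => by
      simp [k, hzero (i, i) (by simp [pairs])]
    refine ⟨⟨k, hs, hd, fun i => ?_⟩, ?_⟩
    · rw [← rowDegree_eq_sum k hs hd, rowDegree_congr hkκ, hrow,
        rowDegree_eq_sum k' hk'.1 hk'.2.1, hk'.2.2]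
    · funext p
      by_cases hp : p ∈ pairs n
      · exact (htr _ p hp).trans (hkκ p hp)
      · rw [hzero p hp]
        exact if_neg hp
end
end

section
/- Let n ≥ 1, d : {1,…,n} → ℕ, and let z₁,…,zₙ and w₁,…,wₙ be spinors in ℂ². Then ∫_{SU(2)} ∏_{i=1}^n [z_i | g·w_i⟩^{d_i} / (d_i)! dg = Σ_{[k]∈K_d} (1/((J+1)! · ∏_{i<j}(k_ij)!)) · ∏_{1≤i<j≤n} ( [z_i|z_j⟩ · [w_i|w_j⟩ )^{k_ij}, where the integral is with respect to the Haar probability measure on SU(2). In particular the integral vanishes whenever K_d is empty (for instance when Σ_i d_i is odd). (This identity expresses the overlap of coherent intertwiners in terms of the discrete-coherent basis.) -/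
/-!
STATEMENT 2: the overlap of coherent intertwiners in terms of the
discrete-coherent basis:
∫_{SU(2)} ∏ᵢ [z_i|g·w_i⟩^{d_i}/(d_i)! dg
  = Σ_{[k]∈K_d} (1/((J+1)!·∏(k_ij)!))·∏_{i<j}([z_i|z_j⟩·[w_i|w_j⟩)^{k_ij}.
The Haar probability measure is formalized as any left-invariant Borel
probability measure on SU(2) (which is unique, hence equal to Haar).
-/

noncomputable section

open MeasureTheory

/-- The group SU(2) of 2×2 complex unitary matrices of determinant one. -/
abbrev SU2 := Matrix.specialUnitaryGroup (Fin 2) ℂ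

instance : MeasurableSpace (Matrix (Fin 2) (Fin 2) ℂ) :=
  (inferInstance : MeasurableSpace (Fin 2 → Fin 2 → ℂ))

open scoped ComplexConjugate

namespace SU2

instance : BorelSpace (Matrix (Fin 2) (Fin 2) ℂ) :=
  inferInstanceAs (BorelSpace (Fin 2 → Fin 2 → ℂ))

instance : CompactSpace SU2 := by
  refine isCompact_iff_compactSpace.mp ?_
  have hK : IsCompact (Set.univ.pi fun _ : Fin 2 => Set.univ.pi fun _ : Fin 2 =>
      Metric.closedBall (0 : ℂ) 1) :=
    isCompact_univ_pi fun _ => isCompact_univ_pi fun _ => isCompact_closedBall _ _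
  refine hK.of_isClosed_subset ?_ fun A hA => ?_
  · have : (Matrix.specialUnitaryGroup (Fin 2) ℂ : Set (Matrix (Fin 2) (Fin 2) ℂ)) =
        {A | A * star A = 1} ∩ {A | A.det = 1} := by
      ext A
      simp [Matrix.mem_specialUnitaryGroup_iff, Matrix.mem_unitaryGroup_iff]
    rw [this]
    exact (isClosed_eq (by fun_prop) continuous_const).inter
      (isClosed_eq (by fun_prop) continuous_const)
  · simp only [Set.mem_pi, Set.mem_univ, forall_const, mem_closedBall_zero_iff]
    exact entry_norm_bound_of_unitary (Matrix.specialUnitaryGroup_le_unitaryGroup hA)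

/-- The linear form `x ↦ (g x)_i` as a continuous function of `g`. -/
def rowForm (i : Fin 2) (x : Spinor) : C(SU2, ℂ) where
  toFun g := (g : Matrix (Fin 2) (Fin 2) ℂ) i 0 * x 0 + (g : Matrix (Fin 2) (Fin 2) ℂ) i 1 * x 1
  continuous_toFun := by
    have h (j : Fin 2) : Continuous fun g : SU2 => (g : Matrix (Fin 2) (Fin 2) ℂ) i j :=
      continuous_subtype_val.matrix_elem i j
    exact ((h 0).mul continuous_const).add ((h 1).mul continuous_const)

lemma rowForm_apply (i : Fin 2) (x : Spinor) (g : SU2) :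
    rowForm i x g =
      (g : Matrix (Fin 2) (Fin 2) ℂ) i 0 * x 0 + (g : Matrix (Fin 2) (Fin 2) ℂ) i 1 * x 1 := rfl

lemma rowForm_mul_sub (x y : Spinor) :
    rowForm 0 x * rowForm 1 y - rowForm 0 y * rowForm 1 x = algebraMap ℂ _ (bra x y) := by
  ext g
  have hg := (Matrix.mem_specialUnitaryGroup_iff.mp g.2).2
  rw [Matrix.det_fin_two] at hg
  simp only [ContinuousMap.sub_apply, ContinuousMap.mul_apply, rowForm_apply, bra,
    algebraMap_apply, smul_eq_mul]
  linear_combination (x 0 * y 1 - x 1 * y 0) * hg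

/-- The element of `SU(2)` with first column `(α, β)`. -/
def ofColumn (α β : ℂ) (h : α * conj α + β * conj β = 1) : SU2 :=
  ⟨!![α, -conj β; β, conj α], by
    rw [Matrix.mem_specialUnitaryGroup_iff, Matrix.mem_unitaryGroup_iff']
    refine ⟨?_, ?_⟩
    · ext i j
      fin_cases i <;> fin_cases j <;>
        simp [Matrix.mul_apply, Fin.sum_univ_two, Matrix.star_apply] <;>
        first | ring1 | linear_combination h
    · rw [Matrix.det_fin_two_of]
      linear_combination h⟩

variable (μ : Measure SU2) [IsProbabilityMeasure μ]

/-- Integration against `μ` as a continuous linear functional. -/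
def integralCLM : C(SU2, ℂ) →L[ℂ] ℂ :=
  LinearMap.mkContinuous
    { toFun := fun f => ∫ g, f g ∂μ
      map_add' := fun f g => integral_add
        (f.continuous.integrable_of_hasCompactSupport (.of_compactSpace _))
        (g.continuous.integrable_of_hasCompactSupport (.of_compactSpace _))
      map_smul' := fun c f => integral_const_mul c _ } 1 fun f => by
    simpa using norm_integral_le_of_norm_le_const (μ := μ) (.of_forall f.norm_coe_le_norm)

lemma integralCLM_apply (f : C(SU2, ℂ)) : integralCLM μ f = ∫ g, f g ∂μ := rfl

lemma integralCLM_one : integralCLM μ 1 = 1 := by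
  simp [integralCLM_apply]

variable [μ.IsMulLeftInvariant]

lemma integralCLM_rotate (x y : Spinor) (p q s : ℕ) (α β : ℂ)
    (h : α * conj α + β * conj β = 1) :
    integralCLM μ ((α • rowForm 0 x - conj β • rowForm 1 x) ^ p *
      (β • rowForm 0 y + conj α • rowForm 1 y) ^ q *
      (β • rowForm 0 x + conj α • rowForm 1 x) ^ s) =
    integralCLM μ (rowForm 0 x ^ p * rowForm 1 y ^ q * rowForm 1 x ^ s) := by
  refine Eq.trans ?_ (integral_mul_left_eq_self (μ := μ) _ (ofColumn α β h))
  rw [integralCLM_apply]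
  congr 1 with g
  simp only [ofColumn, ContinuousMap.mul_apply, ContinuousMap.pow_apply, ContinuousMap.sub_apply,
    ContinuousMap.add_apply, ContinuousMap.smul_apply, rowForm_apply, Submonoid.coe_mul,
    Matrix.mul_apply, Fin.sum_univ_two, smul_eq_mul]
  simp
  ring

lemma integralCLM_eq_zero_of_ne (x y : Spinor) {p q : ℕ} (hpq : p ≠ q) :
    integralCLM μ (rowForm 0 x ^ p * rowForm 1 y ^ q) = 0 := by
  set r : ℝ := Real.pi / (p - q) with hr
  set α := Complex.exp (r * Complex.I) with hα
  have hc : conj α = Complex.exp (-(r * Complex.I)) := by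
    rw [hα, ← Complex.exp_conj]; simp
  have hne : (p - q : ℂ) ≠ 0 := sub_ne_zero.mpr (by exact_mod_cast hpq)
  have hpow : α ^ p * conj α ^ q = -1 := by
    rw [hc, hα, ← Complex.exp_nat_mul, ← Complex.exp_nat_mul, ← Complex.exp_add,
      ← Complex.exp_pi_mul_I]
    congr 1
    rw [hr]
    push_cast
    field_simp
    ring
  have key := integralCLM_rotate μ x y p q 0 α 0
    (by rw [hc, hα, ← Complex.exp_add]; simp)
  simp only [map_zero, zero_smul, sub_zero, zero_add, smul_pow, pow_zero, mul_one,
    smul_mul_smul_comm, hpow, map_smul, smul_eq_mul] at key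
  linear_combination (-1 / 2 : ℂ) * key

lemma integralCLM_infinitesimal (x y : Spinor) (p q : ℕ) (ω : ℂ) (hω : ω * conj ω = 1) :
    integralCLM μ (-conj ω • (((p : ℂ) • (rowForm 0 x ^ (p - 1) * rowForm 1 x)) *
        rowForm 1 y ^ q * rowForm 1 x) +
      ω • ((q : ℂ) • (rowForm 0 x ^ p * (rowForm 1 y ^ (q - 1) * rowForm 0 y) * rowForm 1 x) +
        rowForm 0 x ^ p * rowForm 1 y ^ q * rowForm 0 x)) = 0 := by
  have hcos : HasDerivAt (fun θ : ℝ => (Real.cos θ : ℂ)) 0 0 := by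
    simpa using (Real.hasDerivAt_cos 0).ofReal_comp
  have hsin : HasDerivAt (fun θ : ℝ => (Real.sin θ : ℂ)) 1 0 := by
    simpa using (Real.hasDerivAt_sin 0).ofReal_comp
  have h1 : HasDerivAt (fun θ : ℝ => (Real.cos θ : ℂ) • rowForm 0 x -
      (conj ω * Real.sin θ) • rowForm 1 x) (-conj ω • rowForm 1 x) 0 := by
    refine ((hcos.smul_const (rowForm 0 x)).fun_sub
      ((hsin.const_mul (conj ω)).smul_const (rowForm 1 x))).congr_deriv ?_
    simp
  have h2 (t : Spinor) : HasDerivAt (fun θ : ℝ => (ω * Real.sin θ) • rowForm 0 t +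
      (Real.cos θ : ℂ) • rowForm 1 t) (ω • rowForm 0 t) 0 := by
    refine (((hsin.const_mul ω).smul_const (rowForm 0 t)).fun_add
      (hcos.smul_const (rowForm 1 t))).congr_deriv ?_
    simp
  have h3 := ((h1.fun_pow p).fun_mul ((h2 y).fun_pow q)).fun_mul (h2 x)
  have h4 := ((integralCLM μ).restrictScalars ℝ).hasFDerivAt.comp_hasDerivAt (0 : ℝ) h3
  have h5 : HasDerivAt (fun _ : ℝ =>
      integralCLM μ (rowForm 0 x ^ p * rowForm 1 y ^ q * rowForm 1 x ^ 1)) 0 0 :=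
    hasDerivAt_const _ _
  have h6 := h4.unique (h5.congr_of_eventuallyEq (.of_forall fun θ => ?_))
  · rw [← h6]
    simp only [ContinuousLinearMap.coe_restrictScalars']
    refine congrArg (integralCLM μ) ?_
    ext g
    simp
    ring
  · have hθ : (Real.cos θ : ℂ) * conj (Real.cos θ : ℂ) +
        (ω * Real.sin θ) * conj (ω * Real.sin θ) = 1 := by
      have : (Real.cos θ : ℂ) ^ 2 + (Real.sin θ : ℂ) ^ 2 = 1 := by
        exact_mod_cast Real.cos_sq_add_sin_sq θ
      rw [map_mul (starRingEnd ℂ), Complex.conj_ofReal, Complex.conj_ofReal]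
      linear_combination (Real.sin θ : ℂ) ^ 2 * hω + this
    have := integralCLM_rotate μ x y p q 1 (Real.cos θ) (ω * Real.sin θ) hθ
    rw [map_mul (starRingEnd ℂ), Complex.conj_ofReal, Complex.conj_ofReal] at this
    rw [← this]
    simp

lemma integralCLM_raising (x y : Spinor) (p q : ℕ) :
    integralCLM μ ((q : ℂ) •
        (rowForm 0 x ^ p * (rowForm 1 y ^ (q - 1) * rowForm 0 y) * rowForm 1 x) +
      rowForm 0 x ^ p * rowForm 1 y ^ q * rowForm 0 x) = 0 := by
  have h1 := integralCLM_infinitesimal μ x y p q 1 (by simp)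
  have h2 := integralCLM_infinitesimal μ x y p q Complex.I (by simp)
  rw [map_add, map_smul, map_smul, smul_eq_mul, smul_eq_mul] at h1 h2
  simp only [map_one, Complex.conj_I] at h1 h2
  set P := integralCLM μ (((p : ℂ) • (rowForm 0 x ^ (p - 1) * rowForm 1 x)) *
        rowForm 1 y ^ q * rowForm 1 x)
  set Q := integralCLM μ ((q : ℂ) •
        (rowForm 0 x ^ p * (rowForm 1 y ^ (q - 1) * rowForm 0 y) * rowForm 1 x) +
      rowForm 0 x ^ p * rowForm 1 y ^ q * rowForm 0 x)
  linear_combination (1 / 2 : ℂ) * h1 - (Complex.I / 2) * h2 +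
    ((P + Q) / 2) * Complex.I_mul_I

lemma integralCLM_pow_mul_pow (x y : Spinor) (p : ℕ) :
    integralCLM μ (rowForm 0 x ^ p * rowForm 1 y ^ p) = bra x y ^ p / (p + 1) := by
  induction p with
  | zero => simp [integralCLM_one]
  | succ p ih =>
    have h := integralCLM_raising μ x y p (p + 1)
    have e : ((p + 1 : ℕ) : ℂ) •
        (rowForm 0 x ^ p * (rowForm 1 y ^ (p + 1 - 1) * rowForm 0 y) * rowForm 1 x) +
        rowForm 0 x ^ p * rowForm 1 y ^ (p + 1) * rowForm 0 x =
        ((p : ℂ) + 2) • (rowForm 0 x ^ (p + 1) * rowForm 1 y ^ (p + 1)) -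
        (((p : ℂ) + 1) * bra x y) • (rowForm 0 x ^ p * rowForm 1 y ^ p) := by
      ext g
      have := congrArg (fun f : C(SU2, ℂ) => f g) (rowForm_mul_sub x y)
      simp at this ⊢
      rw [← this]
      ring
    rw [e, map_sub, map_smul, map_smul, ih, smul_eq_mul, smul_eq_mul] at h
    have h1 : (p : ℂ) + 1 ≠ 0 := by exact_mod_cast p.succ_ne_zero
    have h2 : (p : ℂ) + 1 + 1 ≠ 0 := by exact_mod_cast (p + 1).succ_ne_zero
    push_cast
    rw [eq_div_iff h2]
    field_simp at h
    linear_combination h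

lemma integralCLM_add_pow_even (x y : Spinor) (J : ℕ) :
    integralCLM μ ((rowForm 0 x + rowForm 1 y) ^ (2 * J)) =
      ((2 * J).factorial / (J.factorial * (J + 1).factorial) : ℂ) * bra x y ^ J := by
  rw [add_pow, map_sum, Finset.sum_eq_single J]
  · rw [mul_comm, ← nsmul_eq_mul, map_nsmul, show 2 * J - J = J by omega,
      integralCLM_pow_mul_pow, nsmul_eq_mul, Nat.cast_choose ℂ (by omega : J ≤ 2 * J),
      show 2 * J - J = J by omega, Nat.factorial_succ J]
    have h1 : (J : ℂ) + 1 ≠ 0 := by exact_mod_cast J.succ_ne_zero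
    have h2 : (J.factorial : ℂ) ≠ 0 := by exact_mod_cast J.factorial_ne_zero
    push_cast
    field_simp
  · intro k _ hk
    rw [mul_comm, ← nsmul_eq_mul, map_nsmul, integralCLM_eq_zero_of_ne μ x y (by omega),
      smul_zero]
  · intro h
    exact absurd (Finset.mem_range.mpr (by omega)) h

lemma integralCLM_add_pow_odd (x y : Spinor) (m : ℕ) (hm : Odd m) :
    integralCLM μ ((rowForm 0 x + rowForm 1 y) ^ m) = 0 := by
  rw [add_pow, map_sum]
  refine Finset.sum_eq_zero fun k hk => ?_
  rw [Finset.mem_range] at hk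
  obtain ⟨j, rfl⟩ := hm
  rw [mul_comm, ← nsmul_eq_mul, map_nsmul, integralCLM_eq_zero_of_ne μ x y (by omega),
    smul_zero]

end SU2

lemma mem_pairs {n : ℕ} {p : Fin n × Fin n} : p ∈ pairs n ↔ p.1 < p.2 := by
  simp [pairs]

lemma sum_eq_sum_pairs {M : Type*} [AddCommMonoid M] {n : ℕ} (f : Fin n → Fin n → M)
    (hf : ∀ i, f i i = 0) :
    ∑ i, ∑ j, f i j = ∑ p ∈ pairs n, (f p.1 p.2 + f p.2 p.1) := by
  have hswap : ∑ p ∈ pairs n, f p.2 p.1 =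
      ∑ p : Fin n × Fin n, if p.2 < p.1 then f p.1 p.2 else 0 := by
    rw [pairs, Finset.sum_filter]
    exact Fintype.sum_equiv (Equiv.prodComm _ _) _ _ fun p => rfl
  rw [Finset.sum_add_distrib, hswap, pairs, Finset.sum_filter, ← Finset.sum_add_distrib,
    ← Fintype.sum_prod_type']
  refine Finset.sum_congr rfl fun p _ => ?_
  rcases lt_trichotomy p.1 p.2 with h | h | h
  · simp [h, h.not_gt]
  · simp [h, hf]
  · simp [h, h.not_gt]

/-- The degree at vertex `i` of a multiplicity function on pairs. -/
def vertexDegree {n : ℕ} (κ : Fin n × Fin n → ℕ) (i : Fin n) : ℕ :=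
  ∑ p ∈ pairs n, κ p * ((if p.1 = i then 1 else 0) + if p.2 = i then 1 else 0)

lemma vertexDegree_eq {n : ℕ} {k : Fin n → Fin n → ℕ} (hs : ∀ i j, k i j = k j i)
    (h0 : ∀ i, k i i = 0) {κ : Fin n × Fin n → ℕ} (hκ : ∀ p ∈ pairs n, κ p = k p.1 p.2)
    (i : Fin n) : vertexDegree κ i = ∑ j ∈ Finset.univ.erase i, k i j := by
  have h := sum_eq_sum_pairs (fun a b => k a b * if a = i then 1 else 0) (by simp [h0])
  rw [Finset.sum_erase _ (h0 i)]
  calc vertexDegree κ i = ∑ p ∈ pairs n, (k p.1 p.2 * (if p.1 = i then 1 else 0) +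
        k p.2 p.1 * if p.2 = i then 1 else 0) :=
        Finset.sum_congr rfl fun p hp => by rw [hκ p hp, hs p.2 p.1, mul_add]
    _ = ∑ j, k i j := by rw [← h]; simp [Finset.sum_ite_irrel]

lemma IsK.sum_eq {n : ℕ} {d : Fin n → ℕ} {k : Fin n → Fin n → ℕ} (hk : IsK n d k) :
    ∑ i, d i = 2 * Jtot n k := by
  obtain ⟨hs, h0, hd⟩ := hk
  calc ∑ i, d i = ∑ i, ∑ j, k i j :=
        Finset.sum_congr rfl fun i _ => by rw [← hd, Finset.sum_erase _ (h0 i)]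
    _ = ∑ p ∈ pairs n, (k p.1 p.2 + k p.2 p.1) := sum_eq_sum_pairs k h0
    _ = 2 * Jtot n k := by
        rw [Jtot, Finset.mul_sum]
        exact Finset.sum_congr rfl fun p _ => by rw [hs p.2 p.1, two_mul]

/-- Symmetric matrices in `K_d` correspond to multiplicity functions on pairs with degrees `d`. -/
def isKEquiv (n : ℕ) (d : Fin n → ℕ) (J : ℕ) (hJ : ∑ i, d i = 2 * J) :
    {k : Fin n → Fin n → ℕ // IsK n d k} ≃
      {κ // κ ∈ (Finset.piAntidiag (pairs n) J).filter fun κ => vertexDegree κ = d} where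
  toFun k := ⟨fun p => if p.1 < p.2 then k.1 p.1 p.2 else 0, by
    have hp : ∀ p ∈ pairs n, (if p.1 < p.2 then k.1 p.1 p.2 else 0) = k.1 p.1 p.2 :=
      fun p hp => if_pos (mem_pairs.mp hp)
    rw [Finset.mem_filter, Finset.mem_piAntidiag]
    refine ⟨⟨?_, fun p h => mem_pairs.mpr (by by_contra h'; simp [h'] at h)⟩, ?_⟩
    · have := k.2.sum_eq
      rw [Finset.sum_congr rfl hp]
      change Jtot n k.1 = J
      omega
    · ext i
      rw [vertexDegree_eq k.2.1 k.2.2.1 hp, k.2.2.2]⟩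
  invFun κ := ⟨fun i j => if i < j then κ.1 (i, j) else if j < i then κ.1 (j, i) else 0, by
    obtain ⟨κ, hκ⟩ := κ
    rw [Finset.mem_filter] at hκ
    have hs : ∀ i j : Fin n, (if i < j then κ (i, j) else if j < i then κ (j, i) else 0) =
        if j < i then κ (j, i) else if i < j then κ (i, j) else 0 := by
      intro i j
      rcases lt_trichotomy i j with h | h | h
      · simp [h, h.not_gt]
      · simp [h]
      · simp [h, h.not_gt]
    refine ⟨hs, by simp, fun i => ?_⟩
    exact (vertexDegree_eq hs (by simp) (fun p hp => (if_pos (mem_pairs.mp hp)).symm) i).symm.trans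
      (congrFun hκ.2 i)⟩
  left_inv k := by
    obtain ⟨k, hs, h0, hd⟩ := k
    ext i j
    rcases lt_trichotomy i j with h | h | h
    · simp [h]
    · simp [h, h0]
    · simp [h, h.not_gt, hs i j]
  right_inv κ := by
    obtain ⟨κ, hκ⟩ := κ
    rw [Finset.mem_filter, Finset.mem_piAntidiag] at hκ
    ext p
    by_cases h : p.1 < p.2
    · simp [h]
    · have : κ p = 0 := by
        by_contra h'
        exact h (mem_pairs.mp (hκ.1.2 p h'))
      simp [h, this]

section Polynomial

open MvPolynomial

lemma coeff_pairPolynomial_pow {n : ℕ} (B : Fin n × Fin n → ℂ) (d : Fin n → ℕ) (J : ℕ) :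
    coeff (Finsupp.equivFunOnFinite.symm d)
        ((∑ p ∈ pairs n, C (B p) * (X p.1 * X p.2)) ^ J) =
      ∑ κ ∈ (Finset.piAntidiag (pairs n) J).filter fun κ => vertexDegree κ = d,
        (Nat.multinomial (pairs n) κ : ℂ) * ∏ p ∈ pairs n, B p ^ κ p := by
  rw [Finset.sum_pow_eq_sum_piAntidiag, coeff_sum, Finset.sum_filter]
  refine Finset.sum_congr rfl fun κ _ => ?_
  have hmon : (Nat.multinomial (pairs n) κ : MvPolynomial (Fin n) ℂ) *
      ∏ p ∈ pairs n, (C (B p) * (X p.1 * X p.2)) ^ κ p =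
      monomial (∑ p ∈ pairs n, κ p • (Finsupp.single p.1 1 + Finsupp.single p.2 1))
        ((Nat.multinomial (pairs n) κ : ℂ) * ∏ p ∈ pairs n, B p ^ κ p) := by
    rw [← C_mul_monomial, ← C_eq_coe_nat]
    congr 1
    rw [monomial_sum_prod]
    refine Finset.prod_congr rfl fun p _ => ?_
    rw [← monomial_pow, X, X, monomial_mul, C_mul_monomial]
    simp
  rw [hmon, coeff_monomial]
  refine if_congr ?_ rfl rfl
  rw [Equiv.eq_symm_apply, _root_.funext_iff, _root_.funext_iff]
  refine forall_congr' fun i => ?_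
  simp [vertexDegree, Finsupp.single_apply, Finsupp.finsetSum_apply, mul_add]

end Polynomial

namespace SU2

/-- The function `g ↦ [z|g w⟩` on `SU(2)`. -/
def pairing (z w : Spinor) : C(SU2, ℂ) :=
  rowForm 0 (fun j => -(z 1 * w j)) + rowForm 1 (fun j => z 0 * w j)

lemma pairing_apply (z w : Spinor) (g : SU2) :
    pairing z w g = bra z ((g : Matrix (Fin 2) (Fin 2) ℂ).mulVec w) := by
  simp only [pairing, ContinuousMap.add_apply, rowForm_apply, bra, Matrix.mulVec, dotProduct,
    Fin.sum_univ_two]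
  ring

lemma sum_smul_pairing {n : ℕ} (z w : Fin n → Spinor) (t : Fin n → ℂ) :
    ∑ i, t i • pairing (z i) (w i) =
      rowForm 0 (fun j => ∑ i, t i * -(z i 1 * w i j)) +
        rowForm 1 (fun j => ∑ i, t i * (z i 0 * w i j)) := by
  ext g
  simp only [ContinuousMap.sum_apply, ContinuousMap.smul_apply, ContinuousMap.add_apply, pairing,
    rowForm_apply, Finset.mul_sum, ← Finset.sum_add_distrib, smul_eq_mul]
  exact Finset.sum_congr rfl fun i _ => by ring

lemma bra_sum {n : ℕ} (z w : Fin n → Spinor) (t : Fin n → ℂ) :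
    bra (fun j => ∑ i, t i * -(z i 1 * w i j)) (fun j => ∑ i, t i * (z i 0 * w i j)) =
      ∑ p ∈ pairs n,
        bra (z p.1) (z p.2) * bra (w p.1) (w p.2) * (t p.1 * t p.2) := by
  have h := sum_eq_sum_pairs
    (fun i j => t i * t j * (-(z i 1) * z j 0) * bra (w i) (w j)) fun i => by
      simp only [bra]; ring
  calc _ = ∑ i, ∑ j, t i * t j * (-(z i 1) * z j 0) * bra (w i) (w j) := by
        simp only [bra, Finset.sum_mul_sum, ← Finset.sum_sub_distrib]
        exact Finset.sum_congr rfl fun i _ => Finset.sum_congr rfl fun j _ => by ring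
    _ = _ := by
        rw [h]
        exact Finset.sum_congr rfl fun p _ => by simp only [bra]; ring

open MvPolynomial

variable (μ : Measure SU2) [IsProbabilityMeasure μ]

/-- The generating polynomial, in the variables `t`, of the integral of the `m`-th power of
`∑ i, t i * [z i|g (w i)⟩`. -/
def overlapPolynomial {n : ℕ} (z w : Fin n → Spinor) (m : ℕ) : MvPolynomial (Fin n) ℂ :=
  ∑ k ∈ Finset.piAntidiag Finset.univ m, monomial (Finsupp.equivFunOnFinite.symm k)
    (Nat.multinomial Finset.univ k * integralCLM μ (∏ i, pairing (z i) (w i) ^ k i))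

lemma eval_overlapPolynomial {n : ℕ} (z w : Fin n → Spinor) (m : ℕ) (t : Fin n → ℂ) :
    eval t (overlapPolynomial μ z w m) =
      integralCLM μ ((∑ i, t i • pairing (z i) (w i)) ^ m) := by
  rw [overlapPolynomial, Finset.sum_pow_eq_sum_piAntidiag, map_sum, map_sum]
  refine Finset.sum_congr rfl fun k _ => ?_
  rw [eval_monomial, Finsupp.prod_fintype _ _ (by simp)]
  simp only [smul_pow, Finset.prod_smul, ← nsmul_eq_mul, map_nsmul, map_smul, smul_eq_mul,
    Finsupp.equivFunOnFinite_symm_apply_apply]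
  simp only [nsmul_eq_mul]
  ring

lemma coeff_overlapPolynomial {n : ℕ} (z w : Fin n → Spinor) (d : Fin n → ℕ) :
    coeff (Finsupp.equivFunOnFinite.symm d) (overlapPolynomial μ z w (∑ i, d i)) =
      Nat.multinomial Finset.univ d * integralCLM μ (∏ i, pairing (z i) (w i) ^ d i) := by
  rw [overlapPolynomial, coeff_sum, Finset.sum_eq_single d]
  · simp
  · intro k _ hk
    rw [coeff_monomial, if_neg (by simpa using hk)]
  · intro h
    exact absurd (by simp [Finset.mem_piAntidiag]) h

lemma integral_prod_div_factorial {n : ℕ} (z w : Fin n → Spinor) (d : Fin n → ℕ) :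
    ∫ g : SU2, ∏ i, bra (z i) ((g : Matrix (Fin 2) (Fin 2) ℂ).mulVec (w i)) ^ d i
        / (Nat.factorial (d i) : ℂ) ∂μ =
      coeff (Finsupp.equivFunOnFinite.symm d) (overlapPolynomial μ z w (∑ i, d i)) /
        (∑ i, d i).factorial := by
  have hm : (∏ i, ((d i).factorial : ℂ)) * Nat.multinomial Finset.univ d =
      (∑ i, d i).factorial := by
    exact_mod_cast Nat.multinomial_spec Finset.univ d
  have h1 : (∏ i, ((d i).factorial : ℂ)) ≠ 0 :=
    Finset.prod_ne_zero_iff.mpr fun i _ => by exact_mod_cast (d i).factorial_ne_zero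
  have h2 : (Nat.multinomial Finset.univ d : ℂ) ≠ 0 := by
    exact_mod_cast (Nat.multinomial_pos Finset.univ d).ne'
  rw [coeff_overlapPolynomial, ← hm, integralCLM_apply]
  simp only [Finset.prod_div_distrib, integral_div, ContinuousMap.prod_apply,
    ContinuousMap.pow_apply, pairing_apply]
  field_simp

variable [μ.IsMulLeftInvariant]

lemma overlapPolynomial_even {n : ℕ} (z w : Fin n → Spinor) (J : ℕ) :
    overlapPolynomial μ z w (2 * J) =
      C ((2 * J).factorial / (J.factorial * (J + 1).factorial) : ℂ) *
        (∑ p ∈ pairs n,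
          C (bra (z p.1) (z p.2) * bra (w p.1) (w p.2)) * (X p.1 * X p.2)) ^ J := by
  refine MvPolynomial.funext fun t => ?_
  rw [eval_overlapPolynomial, sum_smul_pairing, integralCLM_add_pow_even, bra_sum]
  simp

lemma overlapPolynomial_odd {n : ℕ} (z w : Fin n → Spinor) {m : ℕ} (hm : Odd m) :
    overlapPolynomial μ z w m = 0 := by
  refine MvPolynomial.funext fun t => ?_
  rw [eval_overlapPolynomial, sum_smul_pairing, integralCLM_add_pow_odd μ _ _ m hm, map_zero]

end SU2

theorem coherent_intertwiner_overlap
    (n : ℕ) (hn : 1 ≤ n) (d : Fin n → ℕ) (z w : Fin n → Spinor)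
    (μ : Measure SU2) [IsProbabilityMeasure μ] [μ.IsMulLeftInvariant] :
    (∫ g : SU2, ∏ i : Fin n,
        bra (z i) ((g : Matrix (Fin 2) (Fin 2) ℂ).mulVec (w i)) ^ d i
          / (Nat.factorial (d i) : ℂ) ∂μ)
      = ∑' k : {k : Fin n → Fin n → ℕ // IsK n d k},
          (1 / ((Nat.factorial (Jtot n k.1 + 1) : ℂ)
              * ∏ p ∈ pairs n, (Nat.factorial (k.1 p.1 p.2) : ℂ)))
            * ∏ p ∈ pairs n,
                (bra (z p.1) (z p.2) * bra (w p.1) (w p.2)) ^ k.1 p.1 p.2 := by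
  rw [SU2.integral_prod_div_factorial]
  rcases Nat.even_or_odd (∑ i, d i) with ⟨J, hJ⟩ | hodd
  · rw [← two_mul] at hJ
    rw [hJ, SU2.overlapPolynomial_even, MvPolynomial.coeff_C_mul, coeff_pairPolynomial_pow,
      ← Finset.tsum_subtype, ← (isKEquiv n d J hJ).tsum_eq, ← tsum_mul_left, ← tsum_div_const]
    refine tsum_congr fun k => ?_
    have hk : ∀ p ∈ pairs n, (isKEquiv n d J hJ k).1 p = k.1 p.1 p.2 :=
      fun p hp => if_pos (mem_pairs.mp hp)
    have hJk : Jtot n k.1 = J := by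
      have := k.2.sum_eq
      omega
    have hm : (∏ p ∈ pairs n, ((k.1 p.1 p.2).factorial : ℂ)) *
        Nat.multinomial (pairs n) (fun p => k.1 p.1 p.2) = J.factorial := by
      rw [← hJk]
      exact_mod_cast Nat.multinomial_spec (pairs n) (fun p => k.1 p.1 p.2)
    rw [Nat.multinomial_congr hk, Finset.prod_congr rfl fun p hp => by rw [hk p hp], hJk, ← hm]
    have h1 : (∏ p ∈ pairs n, ((k.1 p.1 p.2).factorial : ℂ)) ≠ 0 :=
      Finset.prod_ne_zero_iff.mpr fun p _ => by exact_mod_cast (k.1 p.1 p.2).factorial_ne_zero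
    have h2 : (Nat.multinomial (pairs n) (fun p => k.1 p.1 p.2) : ℂ) ≠ 0 := by
      exact_mod_cast (Nat.multinomial_pos _ _).ne'
    have h3 : ((2 * J).factorial : ℂ) ≠ 0 := by exact_mod_cast (2 * J).factorial_ne_zero
    have h4 : ((J + 1).factorial : ℂ) ≠ 0 := by exact_mod_cast (J + 1).factorial_ne_zero
    field_simp
  · have : IsEmpty {k : Fin n → Fin n → ℕ // IsK n d k} :=
      ⟨fun k => Nat.not_even_iff_odd.mpr hodd (k.2.sum_eq ▸ even_two_mul _)⟩
    rw [SU2.overlapPolynomial_odd μ z w hodd, tsum_empty]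
    simp
end
end

section
/- Let a, b, c, p, q, r be nonnegative integers and z₁, z₂, z₃, z₄ ∈ ℂ². Then ∫_{ℂ²} ( [z₁|z₂⟩^a · [z₁|w]^b · [z₂|w]^c / (a!·b!·c!) ) · ( [w|z₃⟩^q · [w|z₄⟩^r · [z₃|z₄⟩^p / (q!·r!·p!) ) dμ(w) = Σ over all nonnegative integers k₁₃, k₁₄, k₂₃, k₂₄ with k₁₃+k₁₄ = b, k₂₃+k₂₄ = c, k₁₃+k₂₃ = q, k₁₄+k₂₄ = r of [z₁|z₂⟩^a · [z₃|z₄⟩^p · [z₁|z₃⟩^{k₁₃} · [z₁|z₄⟩^{k₁₄} · [z₂|z₃⟩^{k₂₃} · [z₂|z₄⟩^{k₂₄} / (a!·p!·k₁₃!·k₁₄!·k₂₃!·k₂₄!). (This expresses the 4-valent orthogonal-basis intertwiner |S⟩, obtained by gluing two trivalent intertwiners along a contracted leg, as the sum Σ_T |S,T⟩ of discrete-coherent states.) -/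
/-!
STATEMENT 3: gluing two trivalent intertwiners along a contracted leg gives
the sum over T of discrete-coherent states (|S⟩ = Σ_T |S,T⟩).
-/

noncomputable section

open MeasureTheory

/-- The mixed bracket `[z|w] = z₀·conj(w₀) + z₁·conj(w₁)`. -/
def mix (z w : Spinor) : ℂ :=
  z 0 * starRingEnd ℂ (w 0) + z 1 * starRingEnd ℂ (w 1)

open MvPolynomial

theorem integral_norm_pow_mul_exp_neg_normSq (n : ℕ) :
    ∫ z : ℂ, ‖z‖ ^ n * Real.exp (-Complex.normSq z) =
      Real.pi * Real.Gamma ((n + 2) / 2) := by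
  have h := Complex.integral_rpow_mul_exp_neg_rpow (p := 2) (q := n) (by norm_num)
    (by have : (0 : ℝ) ≤ n := n.cast_nonneg
        linarith)
  simp only [Real.rpow_natCast, Real.rpow_two, ← Complex.normSq_eq_norm_sq] at h
  rw [h]
  ring

theorem integrable_conj_pow_mul_pow_mul_exp (m n : ℕ) :
    Integrable (fun z : ℂ ↦ starRingEnd ℂ z ^ m * z ^ n *
      (Real.pi⁻¹ * Real.exp (-Complex.normSq z) : ℝ)) := by
  have h : Integrable (fun z : ℂ ↦ ‖z‖ ^ (m + n) * Real.exp (-Complex.normSq z)) := by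
    by_contra h
    have h₁ := integral_norm_pow_mul_exp_neg_normSq (m + n)
    rw [integral_undef h] at h₁
    have : 0 < Real.Gamma (((m + n : ℕ) + 2) / 2) := Real.Gamma_pos_of_pos (by positivity)
    have := Real.pi_pos
    have : 0 < Real.pi * Real.Gamma (((m + n : ℕ) + 2) / 2) := by positivity
    linarith
  refine (h.const_mul Real.pi⁻¹).mono' ?_ (Filter.Eventually.of_forall fun z ↦ ?_)
  · refine Continuous.aestronglyMeasurable ?_
    fun_prop
  · simp only [norm_mul, norm_pow, RCLike.norm_conj, Complex.norm_real, Real.norm_eq_abs,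
      Real.abs_exp, abs_inv, abs_of_pos Real.pi_pos]
    apply le_of_eq
    ring

theorem integral_conj_pow_mul_pow_mul_exp (m n : ℕ) :
    ∫ z : ℂ, starRingEnd ℂ z ^ m * z ^ n * (Real.pi⁻¹ * Real.exp (-Complex.normSq z) : ℝ) =
      if m = n then (n.factorial : ℂ) else 0 := by
  split_ifs with hmn
  · subst hmn
    have h (z : ℂ) : starRingEnd ℂ z ^ m * z ^ m *
        (Real.pi⁻¹ * Real.exp (-Complex.normSq z) : ℝ) =
        ((Real.pi⁻¹ * (‖z‖ ^ (2 * m) * Real.exp (-Complex.normSq z)) : ℝ) : ℂ) := by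
      rw [← mul_pow, mul_comm (starRingEnd ℂ z), Complex.mul_conj, Complex.normSq_eq_norm_sq,
        pow_mul]
      push_cast
      ring
    simp_rw [h]
    rw [integral_complex_ofReal, integral_const_mul, integral_norm_pow_mul_exp_neg_normSq,
      inv_mul_cancel_left₀ Real.pi_ne_zero,
      show (((2 * m : ℕ) : ℝ) + 2) / 2 = m + 1 by push_cast; ring, Real.Gamma_nat_eq_factorial]
    norm_cast
  · set I := ∫ z : ℂ, starRingEnd ℂ z ^ m * z ^ n *
      (Real.pi⁻¹ * Real.exp (-Complex.normSq z) : ℝ) with hI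
    have hd : (n : ℂ) - m ≠ 0 := by
      rw [sub_ne_zero]
      exact_mod_cast Ne.symm hmn
    set θ : ℝ := Real.pi / (n - m) with hθ
    have hrot := (rotation (Circle.exp θ)).measurePreserving.integral_comp
      (rotation (Circle.exp θ)).toHomeomorph.measurableEmbedding
      (fun z : ℂ ↦ starRingEnd ℂ z ^ m * z ^ n *
        (Real.pi⁻¹ * Real.exp (-Complex.normSq z) : ℝ))
    have hphase : starRingEnd ℂ (Circle.exp θ : ℂ) ^ m * (Circle.exp θ : ℂ) ^ n = -1 := by
      rw [Circle.coe_exp, ← Complex.exp_conj, ← Complex.exp_nat_mul, ← Complex.exp_nat_mul,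
        ← Complex.exp_add, ← Complex.exp_pi_mul_I]
      congr 1
      simp only [map_mul, Complex.conj_ofReal, Complex.conj_I, hθ]
      push_cast
      field_simp
      ring
    have h (z : ℂ) : starRingEnd ℂ (rotation (Circle.exp θ) z) ^ m *
        rotation (Circle.exp θ) z ^ n *
        (Real.pi⁻¹ * Real.exp (-Complex.normSq (rotation (Circle.exp θ) z)) : ℝ) =
        -(starRingEnd ℂ z ^ m * z ^ n * (Real.pi⁻¹ * Real.exp (-Complex.normSq z) : ℝ)) := by
      have hn : Complex.normSq (rotation (Circle.exp θ) z) = Complex.normSq z := by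
        simp [rotation_apply, Complex.normSq_eq_norm_sq]
      rw [hn, rotation_apply, map_mul, mul_pow, mul_pow]
      linear_combination (starRingEnd ℂ z ^ m * z ^ n *
        (Real.pi⁻¹ * Real.exp (-Complex.normSq z) : ℝ)) * hphase
    simp_rw [h] at hrot
    rw [integral_neg, ← hI] at hrot
    exact self_eq_neg.mp hrot.symm

/-- The integrand `P(conj w) Q(w)` of the Bargmann pairing, times the Gaussian density. -/
def bargmannIntegrand (P Q : MvPolynomial (Fin 2) ℂ) (w : Spinor) : ℂ :=
  eval (fun i ↦ starRingEnd ℂ (w i)) P * eval w Q * (gdens w : ℂ)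

/-- The bilinear pairing of polynomials given by integrating `P(conj w) Q(w)` against the Gaussian
measure on spinors. -/
def bargmannPairing (P Q : MvPolynomial (Fin 2) ℂ) : ℂ := ∫ w, bargmannIntegrand P Q w

theorem bargmannIntegrand_monomial (u v : Fin 2 →₀ ℕ) (s t : ℂ) (w : Spinor) :
    bargmannIntegrand (monomial u s) (monomial v t) w = s * t *
      ∏ i, (starRingEnd ℂ (w i) ^ u i * w i ^ v i *
        (Real.pi⁻¹ * Real.exp (-Complex.normSq (w i)) : ℝ)) := by
  simp only [bargmannIntegrand, eval_monomial, Finsupp.prod_fintype, pow_zero, implies_true,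
    Fin.prod_univ_two, gdens, neg_add, Real.exp_add]
  push_cast
  ring

theorem integrable_bargmannIntegrand (P Q : MvPolynomial (Fin 2) ℂ) :
    Integrable (bargmannIntegrand P Q) := by
  induction P using MvPolynomial.induction_on' with
  | monomial u s =>
    induction Q using MvPolynomial.induction_on' with
    | monomial v t =>
      rw [funext (bargmannIntegrand_monomial u v s t)]
      exact (Integrable.fintype_prod fun i ↦
        integrable_conj_pow_mul_pow_mul_exp (u i) (v i)).const_mul _
    | add Q₁ Q₂ h₁ h₂ =>
      refine (h₁.add h₂).congr (Filter.Eventually.of_forall fun w ↦ ?_)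
      simp only [Pi.add_apply, bargmannIntegrand, map_add]
      ring
  | add P₁ P₂ h₁ h₂ =>
    refine (h₁.add h₂).congr (Filter.Eventually.of_forall fun w ↦ ?_)
    simp only [Pi.add_apply, bargmannIntegrand, map_add]
    ring

theorem bargmannPairing_add_left (P₁ P₂ Q : MvPolynomial (Fin 2) ℂ) :
    bargmannPairing (P₁ + P₂) Q = bargmannPairing P₁ Q + bargmannPairing P₂ Q := by
  rw [bargmannPairing, bargmannPairing, bargmannPairing,
    ← integral_add (integrable_bargmannIntegrand _ _) (integrable_bargmannIntegrand _ _)]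
  refine integral_congr_ae (Filter.Eventually.of_forall fun w ↦ ?_)
  simp only [bargmannIntegrand, map_add]
  ring

theorem bargmannPairing_add_right (P Q₁ Q₂ : MvPolynomial (Fin 2) ℂ) :
    bargmannPairing P (Q₁ + Q₂) = bargmannPairing P Q₁ + bargmannPairing P Q₂ := by
  rw [bargmannPairing, bargmannPairing, bargmannPairing,
    ← integral_add (integrable_bargmannIntegrand _ _) (integrable_bargmannIntegrand _ _)]
  refine integral_congr_ae (Filter.Eventually.of_forall fun w ↦ ?_)
  simp only [bargmannIntegrand, map_add]
  ring

theorem bargmannPairing_C_mul_left (s : ℂ) (P Q : MvPolynomial (Fin 2) ℂ) :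
    bargmannPairing (C s * P) Q = s * bargmannPairing P Q := by
  rw [bargmannPairing, bargmannPairing, ← integral_const_mul]
  refine integral_congr_ae (Filter.Eventually.of_forall fun w ↦ ?_)
  simp only [bargmannIntegrand, map_mul, eval_C]
  ring

theorem bargmannPairing_C_mul_right (s : ℂ) (P Q : MvPolynomial (Fin 2) ℂ) :
    bargmannPairing P (C s * Q) = s * bargmannPairing P Q := by
  rw [bargmannPairing, bargmannPairing, ← integral_const_mul]
  refine integral_congr_ae (Filter.Eventually.of_forall fun w ↦ ?_)
  simp only [bargmannIntegrand, map_mul, eval_C]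
  ring

theorem bargmannPairing_monomial (u v : Fin 2 →₀ ℕ) (s t : ℂ) :
    bargmannPairing (monomial u s) (monomial v t) =
      s * t * ∏ i, if u i = v i then ((v i).factorial : ℂ) else 0 := by
  rw [bargmannPairing, funext (bargmannIntegrand_monomial u v s t), integral_const_mul]
  rw [integral_fintype_prod_volume_eq_prod (fun (i : Fin 2) (z : ℂ) ↦
    starRingEnd ℂ z ^ u i * z ^ v i * (Real.pi⁻¹ * Real.exp (-Complex.normSq z) : ℝ))]
  simp_rw [integral_conj_pow_mul_pow_mul_exp]

/-- Multiplication by a variable is adjoint to differentiation. -/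
theorem bargmannPairing_X_mul (i : Fin 2) (P Q : MvPolynomial (Fin 2) ℂ) :
    bargmannPairing (X i * P) Q = bargmannPairing P (pderiv i Q) := by
  induction P using MvPolynomial.induction_on' with
  | monomial u s =>
    induction Q using MvPolynomial.induction_on' with
    | monomial v t =>
      rw [pderiv_monomial, X, monomial_mul, one_mul, bargmannPairing_monomial,
        bargmannPairing_monomial]
      fin_cases i
      · rcases h : v 0 with _ | k
        · simp [Fin.prod_univ_two, h]
        · simp [Fin.prod_univ_two, h, add_comm 1, Nat.factorial_succ]
          split_ifs <;> ring
      · rcases h : v 1 with _ | k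
        · simp [Fin.prod_univ_two, h]
        · simp [Fin.prod_univ_two, h, add_comm 1, Nat.factorial_succ]
          split_ifs <;> ring
    | add Q₁ Q₂ h₁ h₂ => rw [map_add, bargmannPairing_add_right, h₁, h₂, bargmannPairing_add_right]
  | add P₁ P₂ h₁ h₂ => rw [mul_add, bargmannPairing_add_left, h₁, h₂, bargmannPairing_add_left]

theorem bargmannPairing_one_left (Q : MvPolynomial (Fin 2) ℂ) :
    bargmannPairing 1 Q = constantCoeff Q := by
  induction Q using MvPolynomial.induction_on' with
  | monomial v t =>
    rw [← C_1, C_apply, bargmannPairing_monomial, constantCoeff_monomial]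
    by_cases h : v = 0
    · simp [h]
    · rw [if_neg h]
      obtain ⟨i, hi⟩ := Finsupp.ne_iff.mp h
      rw [Finset.prod_eq_zero (Finset.mem_univ i), mul_zero]
      exact if_neg fun h' ↦ hi h'.symm
  | add Q₁ Q₂ h₁ h₂ => rw [bargmannPairing_add_right, h₁, h₂, map_add]

/-- The linear form whose value at `conj w` is `[z|w]`. -/
def mixForm (z : Spinor) : MvPolynomial (Fin 2) ℂ := C (z 0) * X 0 + C (z 1) * X 1

/-- The linear form whose value at `w` is `[w|z⟩`. -/
def braForm (z : Spinor) : MvPolynomial (Fin 2) ℂ := C (z 1) * X 0 - C (z 0) * X 1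

theorem bargmannPairing_mixForm_mul (z y x : Spinor) (P : MvPolynomial (Fin 2) ℂ) (q r : ℕ) :
    bargmannPairing (mixForm z * P) (braForm x ^ q * braForm y ^ r) =
      q * bra z x * bargmannPairing P (braForm x ^ (q - 1) * braForm y ^ r) +
      r * bra z y * bargmannPairing P (braForm x ^ q * braForm y ^ (r - 1)) := by
  have h₀ (x : Spinor) : pderiv 0 (braForm x) = C (x 1) := by simp [braForm, pderiv_X]
  have h₁ (x : Spinor) : pderiv 1 (braForm x) = C (-x 0) := by simp [braForm, pderiv_X]
  rw [mixForm, add_mul, mul_assoc, mul_assoc, bargmannPairing_add_left,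
    bargmannPairing_C_mul_left, bargmannPairing_C_mul_left, bargmannPairing_X_mul,
    bargmannPairing_X_mul, ← bargmannPairing_C_mul_right, ← bargmannPairing_C_mul_right,
    ← bargmannPairing_add_right, ← bargmannPairing_C_mul_right, ← bargmannPairing_C_mul_right,
    ← bargmannPairing_add_right]
  congr 1
  simp only [Derivation.leibniz, Derivation.leibniz_pow, h₀, h₁, bra, smul_eq_mul, nsmul_eq_mul,
    map_mul, map_sub, map_neg, map_natCast]
  ring

/-- The degree-`n` part of `exp (x * s + y * t)` with `s ^ i * t ^ j` replaced by `f i j`. -/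
def expSum (x y : ℂ) (n : ℕ) (f : ℕ → ℕ → ℂ) : ℂ :=
  ∑ p ∈ Finset.HasAntidiagonal.antidiagonal n,
    x ^ p.1 / (p.1.factorial : ℂ) * (y ^ p.2 / (p.2.factorial : ℂ)) * f p.1 p.2

theorem succ_mul_expSum_succ (x y : ℂ) (n : ℕ) (f : ℕ → ℕ → ℂ) :
    (n + 1 : ℂ) * expSum x y (n + 1) f =
      x * expSum x y n (fun i j ↦ f (i + 1) j) + y * expSum x y n (fun i j ↦ f i (j + 1)) := by
  have hsucc (x : ℂ) (i : ℕ) : ((i + 1 : ℕ) : ℂ) * (x ^ (i + 1) / ((i + 1).factorial : ℂ)) =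
      x * (x ^ i / (i.factorial : ℂ)) := by
    have := Nat.cast_ne_zero (R := ℂ).mpr i.factorial_ne_zero
    have : (i : ℂ) + 1 ≠ 0 := i.cast_add_one_ne_zero
    rw [Nat.factorial_succ]
    push_cast
    field_simp
    ring
  have hsplit : (n + 1 : ℂ) * expSum x y (n + 1) f =
      ∑ p ∈ Finset.HasAntidiagonal.antidiagonal (n + 1), ((p.1 : ℂ) *
        (x ^ p.1 / (p.1.factorial : ℂ)) * (y ^ p.2 / (p.2.factorial : ℂ)) * f p.1 p.2) +
      ∑ p ∈ Finset.HasAntidiagonal.antidiagonal (n + 1), (x ^ p.1 / (p.1.factorial : ℂ) *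
        ((p.2 : ℂ) * (y ^ p.2 / (p.2.factorial : ℂ))) * f p.1 p.2) := by
    rw [expSum, Finset.mul_sum, ← Finset.sum_add_distrib]
    refine Finset.sum_congr rfl fun p hp ↦ ?_
    have h : (n + 1 : ℂ) = p.1 + p.2 := by
      exact_mod_cast (Finset.HasAntidiagonal.mem_antidiagonal.mp hp).symm
    rw [h]
    ring
  rw [hsplit, Finset.Nat.sum_antidiagonal_succ, Finset.Nat.sum_antidiagonal_succ']
  simp only [hsucc, Nat.cast_zero, zero_mul, mul_zero, zero_add, expSum, Finset.mul_sum]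
  congr 1 <;> exact Finset.sum_congr rfl fun p _ ↦ by ring

theorem expSum_zero_fun (x y : ℂ) (n : ℕ) : expSum x y n (fun _ _ ↦ 0) = 0 := by
  simp [expSum]

theorem bargmannPairing_mixForm_pow_mul (z x y : Spinor) (P : MvPolynomial (Fin 2) ℂ)
    (g : ℕ → ℕ → ℂ)
    (hg : ∀ q r : ℕ, bargmannPairing P (braForm x ^ q * braForm y ^ r) =
      (q.factorial * r.factorial : ℂ) * g q r) (n q r : ℕ) :
    bargmannPairing (mixForm z ^ n * P) (braForm x ^ q * braForm y ^ r) =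
      (n.factorial * q.factorial * r.factorial : ℂ) * expSum (bra z x) (bra z y) n
        (fun i j ↦ if i ≤ q ∧ j ≤ r then g (q - i) (r - j) else 0) := by
  induction n generalizing q r with
  | zero => simp [expSum, hg]
  | succ n ih =>
    have hx : (q * bra z x *
        bargmannPairing (mixForm z ^ n * P) (braForm x ^ (q - 1) * braForm y ^ r) : ℂ) =
        (n.factorial * q.factorial * r.factorial : ℂ) * (bra z x *
          expSum (bra z x) (bra z y) n
            (fun i j ↦ if i + 1 ≤ q ∧ j ≤ r then g (q - (i + 1)) (r - j) else 0)) := by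
      rcases q with _ | q
      · simp [expSum_zero_fun]
      · simp only [Nat.add_sub_cancel, ih, Nat.add_le_add_iff_right, Nat.add_sub_add_right,
          Nat.factorial_succ]
        push_cast
        ring
    have hy : (r * bra z y *
        bargmannPairing (mixForm z ^ n * P) (braForm x ^ q * braForm y ^ (r - 1)) : ℂ) =
        (n.factorial * q.factorial * r.factorial : ℂ) * (bra z y *
          expSum (bra z x) (bra z y) n
            (fun i j ↦ if i ≤ q ∧ j + 1 ≤ r then g (q - i) (r - (j + 1)) else 0)) := by
      rcases r with _ | r
      · simp [expSum_zero_fun]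
      · simp only [Nat.add_sub_cancel, ih, Nat.add_le_add_iff_right, Nat.add_sub_add_right,
          Nat.factorial_succ]
        push_cast
        ring
    rw [pow_succ', mul_assoc, bargmannPairing_mixForm_mul, hx, hy, Nat.factorial_succ]
    push_cast
    linear_combination -(n.factorial * q.factorial * r.factorial : ℂ) *
      succ_mul_expSum_succ (bra z x) (bra z y) n
        (fun i j ↦ if i ≤ q ∧ j ≤ r then g (q - i) (r - j) else 0)

theorem bargmannPairing_mixForm_pow_mul_mixForm_pow (z1 z2 z3 z4 : Spinor) (b c q r : ℕ) :
    bargmannPairing (mixForm z1 ^ b * mixForm z2 ^ c) (braForm z3 ^ q * braForm z4 ^ r) =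
      (b.factorial * c.factorial * q.factorial * r.factorial : ℂ) *
        expSum (bra z1 z3) (bra z1 z4) b fun i j ↦ expSum (bra z2 z3) (bra z2 z4) c
          fun k l ↦ if i + k = q ∧ j + l = r then 1 else 0 := by
  have h_one (q r : ℕ) : bargmannPairing 1 (braForm z3 ^ q * braForm z4 ^ r) =
      (q.factorial * r.factorial : ℂ) * if q = 0 ∧ r = 0 then 1 else 0 := by
    rw [bargmannPairing_one_left]
    rcases q with _ | q <;> rcases r with _ | r <;> simp [braForm]
  have h_pow (q r : ℕ) : bargmannPairing (mixForm z2 ^ c) (braForm z3 ^ q * braForm z4 ^ r) =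
      (q.factorial * r.factorial : ℂ) * (c.factorial * expSum (bra z2 z3) (bra z2 z4) c
        fun k l ↦ if k = q ∧ l = r then 1 else 0) := by
    rw [← mul_one (mixForm z2 ^ c), bargmannPairing_mixForm_pow_mul _ _ _ _ _ h_one]
    have hf : (fun k l ↦ if k ≤ q ∧ l ≤ r then (if q - k = 0 ∧ r - l = 0 then 1 else 0) else 0 :
        ℕ → ℕ → ℂ) = fun k l ↦ if k = q ∧ l = r then 1 else 0 := by
      funext k l
      rw [← ite_and]
      exact if_congr (by omega) rfl rfl
    rw [hf]
    ring
  rw [bargmannPairing_mixForm_pow_mul _ _ _ _ _ h_pow]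
  have hf : (fun i j ↦ if i ≤ q ∧ j ≤ r then (c.factorial * expSum (bra z2 z3) (bra z2 z4) c
        fun k l ↦ if k = q - i ∧ l = r - j then 1 else 0) else 0 : ℕ → ℕ → ℂ) =
      fun i j ↦ c.factorial * expSum (bra z2 z3) (bra z2 z4) c
        fun k l ↦ if i + k = q ∧ j + l = r then 1 else 0 := by
    funext i j
    split_ifs with h
    · congr 2
      funext k l
      exact if_congr (by omega) rfl rfl
    · have h0 : (fun k l ↦ if i + k = q ∧ j + l = r then 1 else 0 : ℕ → ℕ → ℂ) =
          fun _ _ ↦ 0 := by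
        funext k l
        exact if_neg (by omega)
      rw [h0, expSum_zero_fun, mul_zero]
  rw [hf]
  simp only [expSum, Finset.mul_sum]
  exact Finset.sum_congr rfl fun _ _ ↦ Finset.sum_congr rfl fun _ _ ↦ by ring

theorem tsum_eq_expSum_expSum (x y u v : ℂ) (b c q r : ℕ) :
    ∑' t : {t : ℕ × ℕ × ℕ × ℕ // t.1 + t.2.1 = b ∧ t.2.2.1 + t.2.2.2 = c ∧
        t.1 + t.2.2.1 = q ∧ t.2.1 + t.2.2.2 = r},
      x ^ t.1.1 / (t.1.1.factorial : ℂ) * (y ^ t.1.2.1 / (t.1.2.1.factorial : ℂ)) *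
        (u ^ t.1.2.2.1 / (t.1.2.2.1.factorial : ℂ) *
          (v ^ t.1.2.2.2 / (t.1.2.2.2.factorial : ℂ))) =
      expSum x y b fun i j ↦ expSum u v c fun k l ↦ if i + k = q ∧ j + l = r then 1 else 0 := by
  have h := tsum_subtype {t : ℕ × ℕ × ℕ × ℕ | t.1 + t.2.1 = b ∧ t.2.2.1 + t.2.2.2 = c ∧
      t.1 + t.2.2.1 = q ∧ t.2.1 + t.2.2.2 = r} (fun t ↦
    x ^ t.1 / (t.1.factorial : ℂ) * (y ^ t.2.1 / (t.2.1.factorial : ℂ)) *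
      (u ^ t.2.2.1 / (t.2.2.1.factorial : ℂ) * (v ^ t.2.2.2 / (t.2.2.2.factorial : ℂ))))
  refine h.trans ?_
  rw [tsum_eq_sum (s := (Finset.HasAntidiagonal.antidiagonal b ×ˢ
      Finset.HasAntidiagonal.antidiagonal c).map (Equiv.prodAssoc ℕ ℕ (ℕ × ℕ)).toEmbedding),
    Finset.sum_map, Finset.sum_product]
  · simp only [expSum, Finset.mul_sum]
    refine Finset.sum_congr rfl fun s hs ↦ Finset.sum_congr rfl fun t ht ↦ ?_
    rw [Finset.HasAntidiagonal.mem_antidiagonal] at hs ht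
    simp only [Set.indicator_apply, Set.mem_ofPred_eq, Equiv.coe_toEmbedding,
      Equiv.prodAssoc_apply, hs, ht, true_and, mul_ite, mul_one, mul_zero]
  · rintro ⟨i, j, k, l⟩ ht
    refine Set.indicator_of_notMem (fun h ↦ ht ?_) _
    simpa using ⟨h.1, h.2.1⟩

theorem glued_trivalent_intertwiners
    (a b c p q r : ℕ) (z1 z2 z3 z4 : Spinor) :
    (∫ w : Spinor,
        (bra z1 z2 ^ a * mix z1 w ^ b * mix z2 w ^ c /
            ((Nat.factorial a : ℂ) * (Nat.factorial b : ℂ) * (Nat.factorial c : ℂ)))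
          * (bra w z3 ^ q * bra w z4 ^ r * bra z3 z4 ^ p /
            ((Nat.factorial q : ℂ) * (Nat.factorial r : ℂ) * (Nat.factorial p : ℂ)))
          * (gdens w : ℂ))
      = ∑' t : {t : ℕ × ℕ × ℕ × ℕ //
            t.1 + t.2.1 = b ∧ t.2.2.1 + t.2.2.2 = c ∧
            t.1 + t.2.2.1 = q ∧ t.2.1 + t.2.2.2 = r},
          bra z1 z2 ^ a * bra z3 z4 ^ p
            * bra z1 z3 ^ t.1.1 * bra z1 z4 ^ t.1.2.1
            * bra z2 z3 ^ t.1.2.2.1 * bra z2 z4 ^ t.1.2.2.2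
            / ((Nat.factorial a : ℂ) * (Nat.factorial p : ℂ)
              * (Nat.factorial t.1.1 : ℂ) * (Nat.factorial t.1.2.1 : ℂ)
              * (Nat.factorial t.1.2.2.1 : ℂ) * (Nat.factorial t.1.2.2.2 : ℂ)) := by
  have h_integrand (w : Spinor) :
      (bra z1 z2 ^ a * mix z1 w ^ b * mix z2 w ^ c /
            ((Nat.factorial a : ℂ) * (Nat.factorial b : ℂ) * (Nat.factorial c : ℂ)))
          * (bra w z3 ^ q * bra w z4 ^ r * bra z3 z4 ^ p /
            ((Nat.factorial q : ℂ) * (Nat.factorial r : ℂ) * (Nat.factorial p : ℂ)))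
          * (gdens w : ℂ) =
        bra z1 z2 ^ a * bra z3 z4 ^ p / (a.factorial * p.factorial) /
          (b.factorial * c.factorial * q.factorial * r.factorial) *
        bargmannIntegrand (mixForm z1 ^ b * mixForm z2 ^ c)
          (braForm z3 ^ q * braForm z4 ^ r) w := by
    have hmix (z : Spinor) : eval (fun i ↦ starRingEnd ℂ (w i)) (mixForm z) = mix z w := by
      simp [mixForm, mix]
    have hbra (z : Spinor) : eval w (braForm z) = bra w z := by
      simp only [braForm, bra, map_sub, map_mul, eval_C, eval_X]
      ring
    simp only [bargmannIntegrand, map_mul, map_pow, hmix, hbra]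
    ring
  simp_rw [h_integrand]
  rw [integral_const_mul, ← bargmannPairing, bargmannPairing_mixForm_pow_mul_mixForm_pow,
    ← mul_assoc, div_mul_cancel₀ _ (by simp [Nat.factorial_ne_zero]), ← tsum_eq_expSum_expSum,
    ← tsum_mul_left]
  refine tsum_congr fun t ↦ ?_
  ring
end
end

section
/- For all natural numbers p, q, m with p + q ≤ m, the following identity of rational numbers holds: Σ_{N=0}^{min(p,q)} (−1)^N · (m−N)! / (N! · (p−N)! · (q−N)!) = (m−p)! · (m−q)! / (p! · q! · (m−p−q)!). (This summation evaluates the norm of the orthogonal basis intertwiners |S⟩ in terms of triangle coefficients.) -/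
/-!
STATEMENT 5: the summation evaluating the norm of the orthogonal basis
intertwiners |S⟩ in terms of triangle coefficients:
Σ_{N=0}^{min(p,q)} (−1)^N·(m−N)!/(N!·(p−N)!·(q−N)!)
  = (m−p)!·(m−q)!/(p!·q!·(m−p−q)!).
-/

/-- Iterated backward differences of a binomial coefficient in its upper argument. -/
theorem alternating_sum_choose_mul_choose_sub (p n b : ℕ) :
    ∑ N ∈ Finset.range (p + 1),
      (-1 : ℚ) ^ N * (p.choose N : ℚ) * ((n + p - N).choose (b + p) : ℚ) = (n.choose b : ℚ) := by
  induction p generalizing n b with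
  | zero => simp
  | succ p ih =>
    have h₁ := ih (n + 1) (b + 1)
    have h₂ := ih n (b + 1)
    rw [Finset.sum_range_succ'] at h₁ ⊢
    have hpascal : ∀ N ∈ Finset.range (p + 1),
        (-1 : ℚ) ^ (N + 1) * ((p + 1).choose (N + 1) : ℚ) *
            ((n + (p + 1) - (N + 1)).choose (b + (p + 1)) : ℚ) =
          (-1 : ℚ) ^ (N + 1) * (p.choose (N + 1) : ℚ) *
            ((n + 1 + p - (N + 1)).choose (b + 1 + p) : ℚ) -
          (-1 : ℚ) ^ N * (p.choose N : ℚ) * ((n + p - N).choose (b + 1 + p) : ℚ) := by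
      intro N _
      rw [show n + (p + 1) - (N + 1) = n + p - N by omega,
        show n + 1 + p - (N + 1) = n + p - N by omega,
        show b + (p + 1) = b + 1 + p by omega, Nat.choose_succ_succ]
      push_cast
      ring
    rw [Finset.sum_congr rfl hpascal, Finset.sum_sub_distrib, h₂, Finset.sum_range_succ]
    have hn : ((n + 1).choose (b + 1) : ℚ) = n.choose b + n.choose (b + 1) := by
      rw [Nat.choose_succ_succ]; push_cast; ring
    rw [show n + (p + 1) - 0 = n + 1 + p - 0 by omega, show b + (p + 1) = b + 1 + p by omega]
    simp only [Nat.choose_succ_self, Nat.choose_zero_right] at h₁ ⊢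
    push_cast at h₁ ⊢
    linarith

theorem triangle_coefficient_sum (p q m : ℕ) (h : p + q ≤ m) :
    (∑ N ∈ Finset.range (min p q + 1),
        (-1 : ℚ) ^ N * (Nat.factorial (m - N) : ℚ) /
          ((Nat.factorial N : ℚ) * (Nat.factorial (p - N) : ℚ) *
            (Nat.factorial (q - N) : ℚ)))
      = (Nat.factorial (m - p) : ℚ) * (Nat.factorial (m - q) : ℚ) /
          ((Nat.factorial p : ℚ) * (Nat.factorial q : ℚ) *
            (Nat.factorial (m - p - q) : ℚ)) := by
  obtain ⟨b, rfl⟩ := Nat.exists_eq_add_of_le h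
  have hsum := alternating_sum_choose_mul_choose_sub p (q + b) b
  have hsub : Finset.range (min p q + 1) ⊆ Finset.range (p + 1) :=
    Finset.range_subset_range.2 (by omega)
  have hzero : ∀ N ∈ Finset.range (p + 1), N ∉ Finset.range (min p q + 1) →
      (-1 : ℚ) ^ N * (p.choose N : ℚ) * ((q + b + p - N).choose (b + p) : ℚ) = 0 := by
    intro N hN hN'
    rw [Finset.mem_range] at hN hN'
    rw [Nat.choose_eq_zero_of_lt (show q + b + p - N < b + p by omega)]
    simp
  rw [← Finset.sum_subset hsub hzero] at hsum
  have hterm : ∀ N ∈ Finset.range (min p q + 1),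
      (-1 : ℚ) ^ N * (Nat.factorial (p + q + b - N) : ℚ) /
          ((Nat.factorial N : ℚ) * (Nat.factorial (p - N) : ℚ) * (Nat.factorial (q - N) : ℚ)) =
        ((b + p).factorial : ℚ) / p.factorial *
          ((-1 : ℚ) ^ N * (p.choose N : ℚ) * ((q + b + p - N).choose (b + p) : ℚ)) := by
    intro N hN
    rw [Finset.mem_range] at hN
    rw [Nat.cast_choose ℚ (show N ≤ p by omega),
      Nat.cast_choose ℚ (show b + p ≤ q + b + p - N by omega),
      show q + b + p - N - (b + p) = q - N by omega,
      show q + b + p - N = p + q + b - N by omega]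
    field_simp
  rw [Finset.sum_congr rfl hterm, ← Finset.mul_sum, hsum,
    Nat.cast_choose ℚ (Nat.le_add_left b q), show p + q + b - p = q + b by omega,
    show p + q + b - q = b + p by omega, show q + b - b = q by omega,
    show q + b - q = b by omega]
  field_simp
end

section
/- Let n ≥ 1, let z₁,…,zₙ ∈ ℂ², and let (k_ij)_{i≠j} be real numbers with k_ij = k_ji. Assume [z_j|z_i⟩ ≠ 0 for all i ≠ j, and assume the critical-point equations hold: for every i and every w ∈ ℂ², Σ_{j≠i} (k_ij / [z_j|z_i⟩) · [z_j|w⟩ = ⟨z_i|w⟩. Then the closure constraint holds: Σ_{i=1}^n |z_i⟩⟨z_i| = (Σ_{i<j} k_ij) · I₂ as 2×2 matrices, and moreover ⟨z_i|z_i⟩ = Σ_{j≠i} k_ij for every i. -/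
/-!
STATEMENT 7: solutions of the critical-point equations satisfy the closure
constraint Σᵢ |z_i⟩⟨z_i| = (Σ_{i<j} k_ij)·I₂ and ⟨z_i|z_i⟩ = Σ_{j≠i} k_ij.
-/

noncomputable section

/-- The Hermitian inner product `⟨z|w⟩`. -/
def herm (z w : Spinor) : ℂ :=
  starRingEnd ℂ (z 0) * w 0 + starRingEnd ℂ (z 1) * w 1

/-- The 2×2 matrix `|z⟩⟨w|` with (A,B) entry `z_A·conj(w_B)`. -/
def ketBraH (z w : Spinor) : Matrix (Fin 2) (Fin 2) ℂ :=
  Matrix.of fun A B => z A * starRingEnd ℂ (w B)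

/-- A sum over ordered pairs of distinct indices, grouped by unordered pairs. -/
lemma sum_erase_eq_sum_lt {ι M : Type*} [Fintype ι] [LinearOrder ι] [AddCommMonoid M]
    (f : ι → ι → M) :
    ∑ i, ∑ j ∈ Finset.univ.erase i, f i j
      = ∑ i, ∑ j ∈ Finset.univ.filter (fun j => i < j), (f i j + f j i) := by
  have hsplit (i : ι) : ∑ j ∈ Finset.univ.erase i, f i j
      = ∑ j ∈ Finset.univ.filter (fun j => i < j), f i j
        + ∑ j ∈ Finset.univ.filter (fun j => j < i), f i j := by
    rw [← Finset.sum_union (Finset.disjoint_filter.2 fun _ _ h => h.not_gt)]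
    refine Finset.sum_congr ?_ fun _ _ => rfl
    ext j
    simp [← lt_or_lt_iff_ne, or_comm]
  have hswap : ∑ i, ∑ j ∈ Finset.univ.filter (fun j => j < i), f i j
      = ∑ i, ∑ j ∈ Finset.univ.filter (fun j => i < j), f j i :=
    Finset.sum_comm' (by simp)
  simp only [hsplit, Finset.sum_add_distrib, hswap]

lemma bra_swap (z w : Spinor) : bra z w = -bra w z := by
  simp only [bra]; ring

/-- The two-dimensional Plücker identity, contracted with a basis spinor. -/
lemma bra_single_mul_sub (z w : Spinor) (A B : Fin 2) :
    bra w (Pi.single B 1) * z A - bra z (Pi.single B 1) * w A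
      = bra w z * (1 : Matrix (Fin 2) (Fin 2) ℂ) A B := by
  fin_cases A <;> fin_cases B <;> simp [bra] <;> ring

lemma herm_single (z : Spinor) (B : Fin 2) :
    herm z (Pi.single B 1) = starRingEnd ℂ (z B) := by
  fin_cases B <;> simp [herm]

theorem critical_points_give_closure
    (n : ℕ) (hn : 1 ≤ n) (z : Fin n → Spinor) (k : Fin n → Fin n → ℝ)
    (hsym : ∀ i j, i ≠ j → k i j = k j i)
    (hbra : ∀ i j, i ≠ j → bra (z j) (z i) ≠ 0)
    (hcrit : ∀ i, ∀ w : Spinor,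
      ∑ j ∈ Finset.univ.erase i, ((k i j : ℂ) / bra (z j) (z i)) * bra (z j) w
        = herm (z i) w) :
    (∑ i : Fin n, ketBraH (z i) (z i))
        = ((∑ i : Fin n, ∑ j ∈ Finset.univ.filter (fun j => i < j), k i j : ℝ) : ℂ)
            • (1 : Matrix (Fin 2) (Fin 2) ℂ)
      ∧ ∀ i, herm (z i) (z i) = ((∑ j ∈ Finset.univ.erase i, k i j : ℝ) : ℂ) := by
  refine ⟨?_, fun i => ?_⟩
  · ext A B
    have hentry (i : Fin n) : z i A * starRingEnd ℂ (z i B)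
        = ∑ j ∈ Finset.univ.erase i,
            (k i j : ℂ) / bra (z j) (z i) * bra (z j) (Pi.single B 1) * z i A := by
      rw [← herm_single, ← hcrit, mul_comm, Finset.sum_mul]
    simp only [Matrix.sum_apply, ketBraH, Matrix.of_apply, hentry, sum_erase_eq_sum_lt,
      Matrix.smul_apply, smul_eq_mul, Complex.ofReal_sum, Finset.sum_mul]
    refine Finset.sum_congr rfl fun i _ => Finset.sum_congr rfl fun j hj => ?_
    have hij : i ≠ j := (Finset.mem_filter.1 hj).2.ne
    have hne := hbra i j hij
    rw [← hsym i j hij, bra_swap (z i) (z j), div_neg]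
    calc _ = (k i j : ℂ) / bra (z j) (z i) *
          (bra (z j) (Pi.single B 1) * z i A - bra (z i) (Pi.single B 1) * z j A) := by ring
      _ = _ := by rw [bra_single_mul_sub, ← mul_assoc, div_mul_cancel₀ _ hne]
  · rw [← hcrit, Complex.ofReal_sum]
    refine Finset.sum_congr rfl fun j hj => ?_
    exact div_mul_cancel₀ _ (hbra i j (Finset.ne_of_mem_erase hj).symm)
end
end

section
/- Let n ≥ 1 and z₁,…,zₙ ∈ ℂ² with A := Σ_{i=1}^n ⟨z_i|z_i⟩ ≠ 0, and assume the closure constraint Σ_{i=1}^n |z_i⟩⟨z_i| = (A/2) · I₂. Then for every i and every w ∈ ℂ²: Σ_{j≠i} conj([z_j|z_i⟩) · [z_j|w⟩ = (A/2) · ⟨z_i|w⟩. Consequently the nonnegative symmetric numbers k_ij := (2/A)·|[z_j|z_i⟩|² (for i ≠ j) solve the critical-point equations Σ_{j≠i} (k_ij/[z_j|z_i⟩)·[z_j|w⟩ = ⟨z_i|w⟩ whenever all the brackets [z_j|z_i⟩ (j ≠ i) are nonzero. -/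
/-!
STATEMENT 8: the closure constraint implies the critical-point equations
with k_ij := (2/A)·|[z_j|z_i⟩|².
-/

noncomputable section

/-- A product of brackets with `z`, written in the entries of `|z⟩⟨z|`. -/
theorem conj_bra_mul_bra (z u w : Spinor) :
    starRingEnd ℂ (bra z u) * bra z w
      = starRingEnd ℂ (u 1) * w 1 * ketBraH z z 0 0
        - starRingEnd ℂ (u 1) * w 0 * ketBraH z z 1 0
        - starRingEnd ℂ (u 0) * w 1 * ketBraH z z 0 1
        + starRingEnd ℂ (u 0) * w 0 * ketBraH z z 1 1 := by
  simp only [bra, ketBraH, Matrix.of_apply, map_sub, map_mul]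
  ring

theorem sum_conj_bra_mul_bra {ι : Type*} [Fintype ι] (z : ι → Spinor) (c : ℂ)
    (h : (∑ i, ketBraH (z i) (z i)) = c • (1 : Matrix (Fin 2) (Fin 2) ℂ)) (u w : Spinor) :
    ∑ j, starRingEnd ℂ (bra (z j) u) * bra (z j) w = c * herm u w := by
  have entry (a b : Fin 2) :
      ∑ i, ketBraH (z i) (z i) a b = (c • (1 : Matrix (Fin 2) (Fin 2) ℂ)) a b := by
    rw [← h, Matrix.sum_apply]
  simp only [conj_bra_mul_bra, Finset.sum_add_distrib, Finset.sum_sub_distrib, ← Finset.mul_sum,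
    entry]
  simp [herm]
  ring

theorem closure_gives_critical_points
    (n : ℕ) (hn : 1 ≤ n) (z : Fin n → Spinor)
    (A : ℂ) (hA : A = ∑ i : Fin n, herm (z i) (z i)) (hA0 : A ≠ 0)
    (hclosure : (∑ i : Fin n, ketBraH (z i) (z i))
      = (A / 2) • (1 : Matrix (Fin 2) (Fin 2) ℂ)) :
    (∀ i, ∀ w : Spinor,
        ∑ j ∈ Finset.univ.erase i,
            starRingEnd ℂ (bra (z j) (z i)) * bra (z j) w
          = (A / 2) * herm (z i) w)
      ∧ ∀ i, (∀ j, j ≠ i → bra (z j) (z i) ≠ 0) → ∀ w : Spinor,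
          ∑ j ∈ Finset.univ.erase i,
              ((2 / A * (Complex.normSq (bra (z j) (z i)) : ℂ)) / bra (z j) (z i))
                * bra (z j) w
            = herm (z i) w := by
  have key (i : Fin n) (w : Spinor) :
      ∑ j ∈ Finset.univ.erase i, starRingEnd ℂ (bra (z j) (z i)) * bra (z j) w
        = (A / 2) * herm (z i) w := by
    rw [Finset.sum_erase, sum_conj_bra_mul_bra z (A / 2) hclosure]
    have : bra (z i) (z i) = 0 := by unfold bra; ring
    simp [this]
  refine ⟨key, fun i hi w => ?_⟩
  calc
    _ = ∑ j ∈ Finset.univ.erase i,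
          2 / A * (starRingEnd ℂ (bra (z j) (z i)) * bra (z j) w) := by
      refine Finset.sum_congr rfl fun j hj => ?_
      have hb := hi j (Finset.ne_of_mem_erase hj)
      rw [← Complex.mul_conj]
      field_simp
    _ = herm (z i) w := by
      rw [← Finset.mul_sum, key]
      field_simp
end
end

section
/- Let k : Fin 5 → Fin 5 → Fin 5 → ℝ (written k^a_{ij} := k a i j) and α : Fin 5 → Fin 5 → Fin 5 → ℝ (written α^{ai}_b := α a i b) be real families. Assume the symmetry k^a_{ij} = k^a_{ji} for all pairwise distinct a,i,j, and assume that the spins j_{ai} := (1/2)·Σ_{j∉{a,i}} k^a_{ij} satisfy j_{ai} = j_{ia} for all a ≠ i. Define ξ^{ab}_i := α^{ab}_i + α^{ba}_i, ξ^{ab} := (1/3)·Σ_{i∉{a,b}} ξ^{ab}_i, α^{ai}_{jk} := α^{ai}_j − α^{ai}_k, and α^a_{ij} := (1/6)·Σ_{b∉{a,i,j}} ( α^{ai}_{jb} + α^{aj}_{ib} ). Then (1/2)·Σ_{(a,i,j) pairwise distinct} k^a_{ij} · α^{ai}_j = Σ_{a<b} j_{ab} · ξ^{ab} + Σ_a Σ_{i<j,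 i≠a, j≠a} k^a_{ij} · α^a_{ij}. (This is the on-shell action of the 20j symbol: the generalization of the Regge action to twisted geometry, S = Σ_{t} j_t ξ^t + Σ k α.) -/
/-!
STATEMENT 9: the on-shell action of the 20j symbol: the generalization of
the Regge action to twisted geometry,
(1/2)·Σ_{(a,i,j) distinct} k^a_{ij}·α^{ai}_j
    = Σ_{a<b} j_{ab}·ξ^{ab} + Σ_a Σ_{i<j} k^a_{ij}·α^a_{ij}.
-/

noncomputable section

open Finset

/-- The spin `j_{ai} = (1/2)·Σ_{j∉{a,i}} k^a_{ij}`. -/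
def spin (k : Fin 5 → Fin 5 → Fin 5 → ℝ) (a i : Fin 5) : ℝ :=
  (1 / 2) * ∑ j ∈ (univ.erase a).erase i, k a i j

/-- `ξ^{ab}_i = α^{ab}_i + α^{ba}_i`. -/
def xiI (α : Fin 5 → Fin 5 → Fin 5 → ℝ) (a b i : Fin 5) : ℝ := α a b i + α b a i

/-- `ξ^{ab} = (1/3)·Σ_{i∉{a,b}} ξ^{ab}_i`. -/
def xiAv (α : Fin 5 → Fin 5 → Fin 5 → ℝ) (a b : Fin 5) : ℝ :=
  (1 / 3) * ∑ i ∈ (univ.erase a).erase b, xiI α a b i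

/-- `α^{ai}_{jk} = α^{ai}_j − α^{ai}_k`. -/
def alphaDiff (α : Fin 5 → Fin 5 → Fin 5 → ℝ) (a i j k : Fin 5) : ℝ :=
  α a i j - α a i k

/-- `α^a_{ij} = (1/6)·Σ_{b∉{a,i,j}} (α^{ai}_{jb} + α^{aj}_{ib})`. -/
def alphaAv (α : Fin 5 → Fin 5 → Fin 5 → ℝ) (a i j : Fin 5) : ℝ :=
  (1 / 6) * ∑ b ∈ ((univ.erase a).erase i).erase j,
    (alphaDiff α a i j b + alphaDiff α a j i b)

/-- A sum over ordered pairs of distinct elements, grouped by unordered pairs. -/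
theorem sum_offDiag_eq_sum_lt {ι M : Type*} [Fintype ι] [LinearOrder ι] [AddCommMonoid M]
    (s : Finset ι) (f : ι → ι → M) :
    ∑ i ∈ s, ∑ j ∈ s.erase i, f i j
      = ∑ i ∈ s, ∑ j ∈ s.erase i ∩ univ.filter (fun j => i < j), (f i j + f j i) := by
  have hlt (i : ι) : s.erase i ∩ univ.filter (fun j => i < j) = s.filter (fun j => i < j) := by
    ext j
    simp only [mem_inter, mem_erase, mem_filter, mem_univ, true_and]
    exact ⟨fun h => ⟨h.1.2, h.2⟩, fun h => ⟨⟨h.2.ne', h.1⟩, h.2⟩⟩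
  have hsplit (i : ι) : ∑ j ∈ s.erase i, f i j
      = ∑ j ∈ s, (if i < j then f i j else 0) + ∑ j ∈ s, (if j < i then f i j else 0) := by
    rw [← filter_ne', sum_filter, ← sum_add_distrib]
    refine sum_congr rfl fun j _ => ?_
    rcases lt_trichotomy i j with h | rfl | h
    · simp [h, h.ne', h.not_gt]
    · simp
    · simp [h, h.ne, h.not_gt]
  simp only [hlt, hsplit, sum_add_distrib, sum_filter]
  congr 1
  exact sum_comm

/-- Deviation of `α^{ai}_j` from its mean over `j ∉ {a, i}`. -/
theorem eq_mean_add_alphaDiff (α : Fin 5 → Fin 5 → Fin 5 → ℝ) {a i j : Fin 5}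
    (hai : a ≠ i) (haj : a ≠ j) (hij : i ≠ j) :
    α a i j = (1 / 3) * ∑ b ∈ (univ.erase a).erase i, α a i b
      + (1 / 3) * ∑ b ∈ ((univ.erase a).erase i).erase j, alphaDiff α a i j b := by
  have hj : j ∈ (univ.erase a).erase i := by simp [haj.symm, hij.symm]
  have hcard : #(((univ.erase a).erase i).erase j) = 2 := by
    rw [card_erase_of_mem hj, card_erase_of_mem (by simp [hai.symm]),
      card_erase_of_mem (mem_univ a)]
    simp
  rw [← add_sum_erase _ _ hj]
  simp only [alphaDiff, sum_sub_distrib, sum_const, hcard, nsmul_eq_mul]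
  push_cast
  ring

theorem twisted_geometry_action
    (k : Fin 5 → Fin 5 → Fin 5 → ℝ) (α : Fin 5 → Fin 5 → Fin 5 → ℝ)
    (hksym : ∀ a i j : Fin 5, a ≠ i → a ≠ j → i ≠ j → k a i j = k a j i)
    (hspin : ∀ a i : Fin 5, a ≠ i → spin k a i = spin k i a) :
    (1 / 2) * (∑ a : Fin 5, ∑ i ∈ univ.erase a, ∑ j ∈ (univ.erase a).erase i,
        k a i j * α a i j)
      = (∑ a : Fin 5, ∑ b ∈ univ.filter (fun b => a < b), spin k a b * xiAv α a b)
        + ∑ a : Fin 5, ∑ i ∈ univ.erase a,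
            ∑ j ∈ (univ.erase a).erase i ∩ univ.filter (fun j => i < j),
              k a i j * alphaAv α a i j := by
  have hmean : ∑ a : Fin 5, ∑ b ∈ univ.filter (fun b => a < b), spin k a b * xiAv α a b
      = ∑ a : Fin 5, ∑ i ∈ univ.erase a,
          spin k a i * ((1 / 3) * ∑ b ∈ (univ.erase a).erase i, α a i b) := by
    rw [sum_offDiag_eq_sum_lt]
    refine sum_congr rfl fun a _ => ?_
    have hlt : univ.erase a ∩ univ.filter (fun b => a < b) = univ.filter (fun b => a < b) := by
      ext b
      simp
    rw [hlt]
    refine sum_congr rfl fun b hb => ?_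
    have hab : a < b := by simpa using hb
    rw [← hspin a b hab.ne, erase_right_comm (a := b) (b := a), xiAv]
    simp only [xiI, sum_add_distrib]
    ring
  have hdev (a : Fin 5) : ∑ i ∈ univ.erase a,
        ∑ j ∈ (univ.erase a).erase i ∩ univ.filter (fun j => i < j), k a i j * alphaAv α a i j
      = ∑ i ∈ univ.erase a, ∑ j ∈ (univ.erase a).erase i,
          k a i j * ((1 / 6) * ∑ b ∈ ((univ.erase a).erase i).erase j, alphaDiff α a i j b) := by
    rw [sum_offDiag_eq_sum_lt]
    refine sum_congr rfl fun i hi => sum_congr rfl fun j hj => ?_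
    simp only [mem_inter, mem_erase, mem_filter, mem_univ, true_and, and_true] at hi hj
    rw [← hksym a i j (Ne.symm hi) (Ne.symm hj.1.2) hj.2.ne,
      erase_right_comm (a := j) (b := i), alphaAv, sum_add_distrib]
    ring
  rw [hmean, sum_congr rfl fun a _ => hdev a, ← sum_add_distrib, mul_sum]
  refine sum_congr rfl fun a _ => ?_
  rw [← sum_add_distrib, mul_sum]
  refine sum_congr rfl fun i hi => ?_
  rw [spin, mul_assoc, sum_mul, mul_sum, mul_sum, ← sum_add_distrib]
  refine sum_congr rfl fun j hj => ?_
  simp only [mem_erase, mem_univ, and_true] at hi hj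
  linear_combination (1 / 2) * k a i j *
    eq_mean_add_alphaDiff α (Ne.symm hi) (Ne.symm hj.2) (Ne.symm hj.1)
end
end

section
/- Let J be a natural number and let f be a continuous complex-valued function on the 2×2 complex matrices that is homogeneous of degree 2J in the sense that f(r·g) = r^{2J}·f(g) for every real r ≥ 0 and every g. Define G : ℂ² → M₂(ℂ) by G(z) := [[conj(z₀), conj(z₁)], [−z₁, z₀]] for z = (z₀,z₁) (so that G(z) = ‖z‖ times an element of SU(2) when z ≠ 0). Then ∫_{ℂ²} f(G(z)) dμ(z) = (J+1)! · ∫_{SU(2)} f(g) dg, where dg is the Haar probability measure on SU(2). -/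
/-!
STATEMENT 10: for f homogeneous of degree 2J,
∫_{ℂ²} f(G(z)) dμ(z) = (J+1)!·∫_{SU(2)} f(g) dg,
where G(z) = [[conj z₀, conj z₁], [−z₁, z₀]].
The Haar probability measure is formalized as any left-invariant Borel
probability measure on SU(2) (which is unique, hence equal to Haar).
-/

noncomputable section

open MeasureTheory

/-- The matrix `G(z) = [[conj z₀, conj z₁], [−z₁, z₀]]`. -/
def Gmat (z : Spinor) : Matrix (Fin 2) (Fin 2) ℂ :=
  !![starRingEnd ℂ (z 0), starRingEnd ℂ (z 1); -(z 1), z 0]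

/-- The squared norm `⟨z|z⟩` on `ℂ²`. -/
def spinorNormSq (z : Spinor) : ℝ := Complex.normSq (z 0) + Complex.normSq (z 1)

lemma spinorNormSq_nonneg (z : Spinor) : 0 ≤ spinorNormSq z :=
  add_nonneg (Complex.normSq_nonneg _) (Complex.normSq_nonneg _)

lemma continuous_spinorNormSq : Continuous spinorNormSq := by
  unfold spinorNormSq
  have := Complex.continuous_normSq
  fun_prop

lemma gdens_eq (z : Spinor) : gdens z = Real.pi⁻¹ ^ 2 * Real.exp (-spinorNormSq z) := rfl

lemma gdens_nonneg (z : Spinor) : 0 ≤ gdens z := by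
  unfold gdens
  positivity

lemma continuous_gdens : Continuous gdens := by
  have := continuous_spinorNormSq
  simp only [funext gdens_eq]
  fun_prop

lemma continuous_Gmat : Continuous Gmat := by
  refine continuous_matrix fun i j => ?_
  fin_cases i <;> fin_cases j <;> simp only [Gmat] <;> simp <;> fun_prop

lemma det_Gmat (z : Spinor) : (Gmat z).det = spinorNormSq z := by
  simp [Gmat, spinorNormSq, Matrix.det_fin_two, Complex.normSq_eq_conj_mul_self]

lemma Gmat_mem_SU2 {z : Spinor} (hz : spinorNormSq z = 1) : Gmat z ∈ SU2 := by
  have h : (starRingEnd ℂ (z 0)) * z 0 + (starRingEnd ℂ (z 1)) * z 1 = 1 := by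
    rw [← Complex.normSq_eq_conj_mul_self, ← Complex.normSq_eq_conj_mul_self]
    exact_mod_cast hz
  refine Matrix.mem_specialUnitaryGroup_iff.2 ⟨Matrix.mem_unitaryGroup_iff.2 ?_, ?_⟩
  · ext i j
    fin_cases i <;> fin_cases j <;>
      simp [Gmat, Matrix.mul_apply, Fin.sum_univ_two] <;>
      first | ring1 | linear_combination h
  · simp [det_Gmat, hz]

/-- Polar decomposition: `G(z)` is `‖z‖` times an element of `SU(2)`. -/
lemma exists_Gmat_eq_smul (z : Spinor) :
    ∃ v : SU2, Gmat z = √(spinorNormSq z) • (v : Matrix (Fin 2) (Fin 2) ℂ) := by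
  set r := √(spinorNormSq z) with hr
  have hsq : r ^ 2 = spinorNormSq z := Real.sq_sqrt (spinorNormSq_nonneg z)
  rcases eq_or_ne r 0 with h | h
  · refine ⟨1, ?_⟩
    have h0 : Complex.normSq (z 0) + Complex.normSq (z 1) = 0 := by
      simpa [h, spinorNormSq] using hsq.symm
    have hz0 : z 0 = 0 := Complex.normSq_eq_zero.1
      (by linarith [Complex.normSq_nonneg (z 0), Complex.normSq_nonneg (z 1)])
    have hz1 : z 1 = 0 := Complex.normSq_eq_zero.1
      (by linarith [Complex.normSq_nonneg (z 0), Complex.normSq_nonneg (z 1)])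
    ext i j
    fin_cases i <;> fin_cases j <;> simp [Gmat, h, hz0, hz1]
  · refine ⟨⟨Gmat (r⁻¹ • z), Gmat_mem_SU2 ?_⟩, ?_⟩
    · have : spinorNormSq (r⁻¹ • z) = (r⁻¹) ^ 2 * spinorNormSq z := by
        simp [spinorNormSq]
        ring
      rw [this, ← hsq]
      field_simp
    · have hc : (r : ℂ) ≠ 0 := by exact_mod_cast h
      ext i j
      fin_cases i <;> fin_cases j <;> simp [Gmat, hc]

lemma star_eq_adjugate_of_mem_SU2 (u : SU2) :
    star (u : Matrix (Fin 2) (Fin 2) ℂ) = (u : Matrix (Fin 2) (Fin 2) ℂ).adjugate := by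
  obtain ⟨hu, hdet⟩ := Matrix.mem_specialUnitaryGroup_iff.1 u.2
  have h1 := Matrix.mem_unitaryGroup_iff'.1 hu
  calc star (u : Matrix (Fin 2) (Fin 2) ℂ)
      = star (u : Matrix (Fin 2) (Fin 2) ℂ) * (u * (u : Matrix (Fin 2) (Fin 2) ℂ).adjugate) := by
        rw [Matrix.mul_adjugate, hdet, one_smul, mul_one]
    _ = _ := by rw [← mul_assoc, h1, one_mul]

lemma Gmat_mul (z : Spinor) (u : SU2) :
    Gmat z * (u : Matrix (Fin 2) (Fin 2) ℂ)
      = Gmat ((u : Matrix (Fin 2) (Fin 2) ℂ).adjugate.mulVec z) := by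
  have h := star_eq_adjugate_of_mem_SU2 u
  have h00 := congrFun (congrFun h 0) 0
  have h01 := congrFun (congrFun h 0) 1
  have h10 := congrFun (congrFun h 1) 0
  have h11 := congrFun (congrFun h 1) 1
  simp [Matrix.adjugate_fin_two, Matrix.star_apply] at h00 h01 h10 h11
  ext i j
  fin_cases i <;> fin_cases j <;>
    simp [Gmat, Matrix.mul_apply, Fin.sum_univ_two, Matrix.adjugate_fin_two, Matrix.mulVec,
      dotProduct, h00, h01, h10, h11] <;> ring

lemma spinorNormSq_mulVec_adjugate (z : Spinor) (u : SU2) :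
    spinorNormSq ((u : Matrix (Fin 2) (Fin 2) ℂ).adjugate.mulVec z) = spinorNormSq z := by
  have h := congrArg Matrix.det (Gmat_mul z u)
  rw [Matrix.det_mul, (Matrix.mem_specialUnitaryGroup_iff.1 u.2).2, mul_one, det_Gmat,
    det_Gmat] at h
  exact_mod_cast h.symm

lemma measurePreserving_mulVec {A : Matrix (Fin 2) (Fin 2) ℂ} (hA : A.det = 1) :
    MeasurePreserving (fun z : Spinor => A.mulVec z) := by
  have hdet : LinearMap.det ((Matrix.toLin' A).restrictScalars ℝ) = 1 := by
    rw [LinearMap.det_restrictScalars, LinearMap.det_toLin', hA, map_one]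
  refine ⟨by fun_prop, ?_⟩
  have := Measure.map_linearMap_addHaar_eq_smul_addHaar (volume : Measure Spinor)
    (f := (Matrix.toLin' A).restrictScalars ℝ) (by rw [hdet]; exact one_ne_zero)
  rw [hdet] at this
  rwa [inv_one, abs_one, ENNReal.ofReal_one, one_smul] at this

/-- Right multiplication by `SU(2)` leaves the Gaussian integral unchanged. -/
lemma integral_Gmat_mul (f : Matrix (Fin 2) (Fin 2) ℂ → ℂ) (hf : Continuous f) (u : SU2) :
    ∫ z : Spinor, f (Gmat z * u) * (gdens z : ℂ) = ∫ z : Spinor, f (Gmat z) * (gdens z : ℂ) := by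
  have hdet : (u : Matrix (Fin 2) (Fin 2) ℂ).adjugate.det = 1 := by
    rw [Matrix.det_adjugate, (Matrix.mem_specialUnitaryGroup_iff.1 u.2).2, one_pow]
  have hmp := measurePreserving_mulVec hdet
  have hc : Continuous fun z : Spinor => f (Gmat z) * (gdens z : ℂ) :=
    (hf.comp continuous_Gmat).mul (Complex.continuous_ofReal.comp continuous_gdens)
  rw [← hmp.map_eq, integral_map hmp.aemeasurable hc.aestronglyMeasurable, hmp.map_eq]
  refine integral_congr_ae (.of_forall fun z => ?_)
  simp only [Gmat_mul, gdens_eq, spinorNormSq_mulVec_adjugate]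

/-- The Gaussian moments in one complex dimension. -/
lemma integral_normSq_pow_mul_exp (k : ℕ) :
    ∫ z : ℂ, Complex.normSq z ^ k * Real.exp (-Complex.normSq z) = Real.pi * k.factorial := by
  have h := Complex.integral_rpow_mul_exp_neg_rpow (p := 2) (q := 2 * k) (by norm_num)
    (by have : (0 : ℝ) ≤ k := k.cast_nonneg
        linarith)
  have h2 : ((2 * k + 2 : ℝ) / 2) = k + 1 := by ring
  rw [h2, Real.Gamma_nat_eq_factorial] at h
  rw [show Real.pi * (k.factorial : ℝ) = 2 * Real.pi / 2 * k.factorial by ring, ← h]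
  refine integral_congr_ae (.of_forall fun z => ?_)
  have : (‖z‖ : ℝ) ^ (2 * k : ℝ) = Complex.normSq z ^ k := by
    rw [Complex.normSq_eq_norm_sq, ← pow_mul]
    exact_mod_cast Real.rpow_natCast _ _
  simp only [this, Complex.normSq_eq_norm_sq, Real.rpow_two]

lemma integrable_normSq_pow_mul_exp (k : ℕ) :
    Integrable fun z : ℂ => Complex.normSq z ^ k * Real.exp (-Complex.normSq z) := by
  refine Integrable.of_integral_ne_zero ?_
  rw [integral_normSq_pow_mul_exp]
  positivity

lemma spinorNormSq_pow_mul_exp (J : ℕ) (z : Spinor) :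
    spinorNormSq z ^ J * Real.exp (-spinorNormSq z)
      = ∑ k ∈ Finset.range (J + 1), (J.choose k : ℝ) * ∏ i : Fin 2,
        (Complex.normSq (z i) ^ (![k, J - k] i) * Real.exp (-Complex.normSq (z i))) := by
  rw [spinorNormSq, add_pow, Finset.sum_mul]
  refine Finset.sum_congr rfl fun k _ => ?_
  simp only [Fin.prod_univ_two, neg_add, Real.exp_add, Matrix.cons_val_zero, Matrix.cons_val_one]
  ring

lemma integrable_spinorNormSq_pow_mul_gdens (J : ℕ) :
    Integrable fun z : Spinor => spinorNormSq z ^ J * gdens z := by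
  have h : Integrable fun z : Spinor => spinorNormSq z ^ J * Real.exp (-spinorNormSq z) := by
    simp only [spinorNormSq_pow_mul_exp]
    refine integrable_finsetSum _ fun k _ => Integrable.const_mul ?_ _
    exact Integrable.fintype_prod (f := fun (i : Fin 2) (w : ℂ) =>
      Complex.normSq w ^ (![k, J - k] i) * Real.exp (-Complex.normSq w))
      fun i => integrable_normSq_pow_mul_exp _
  simpa only [gdens_eq, mul_left_comm] using h.const_mul (Real.pi⁻¹ ^ 2)

/-- The radial Gaussian moments on `ℂ²`. -/
lemma integral_spinorNormSq_pow_mul_gdens (J : ℕ) :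
    ∫ z : Spinor, spinorNormSq z ^ J * gdens z = (J + 1).factorial := by
  simp only [gdens_eq, mul_left_comm _ (Real.pi⁻¹ ^ 2), integral_const_mul,
    spinorNormSq_pow_mul_exp]
  rw [integral_finsetSum]
  · have h : ∀ k ∈ Finset.range (J + 1), ∫ z : Spinor, (J.choose k : ℝ) * ∏ i : Fin 2,
        (Complex.normSq (z i) ^ (![k, J - k] i) * Real.exp (-Complex.normSq (z i)))
          = Real.pi ^ 2 * J.factorial := by
      intro k hk
      have hk' : k ≤ J := Nat.lt_succ_iff.1 (Finset.mem_range.1 hk)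
      rw [integral_const_mul, integral_fintype_prod_volume_eq_prod (fun (i : Fin 2) (w : ℂ) =>
        Complex.normSq w ^ (![k, J - k] i) * Real.exp (-Complex.normSq w))]
      simp only [integral_normSq_pow_mul_exp, Fin.prod_univ_two, Matrix.cons_val_zero,
        Matrix.cons_val_one]
      rw [← Nat.choose_mul_factorial_mul_factorial hk']
      push_cast
      ring
    rw [Finset.sum_congr rfl h, Finset.sum_const, Finset.card_range, Nat.factorial_succ]
    have := Real.pi_ne_zero
    push_cast
    simp only [nsmul_eq_mul]
    field_simp
    push_cast
    ring
  · refine fun k _ => Integrable.const_mul ?_ _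
    exact Integrable.fintype_prod (f := fun (i : Fin 2) (w : ℂ) =>
      Complex.normSq w ^ (![k, J - k] i) * Real.exp (-Complex.normSq w))
      fun i => integrable_normSq_pow_mul_exp _

lemma exists_bound_on_SU2 (f : Matrix (Fin 2) (Fin 2) ℂ → ℂ) (hf : Continuous f) :
    ∃ C : ℝ, ∀ g : SU2, ‖f g‖ ≤ C := by
  have hK : IsCompact (Set.univ.pi fun _ : Fin 2 => Set.univ.pi fun _ : Fin 2 =>
      Metric.closedBall (0 : ℂ) 1) :=
    isCompact_univ_pi fun _ => isCompact_univ_pi fun _ => isCompact_closedBall _ _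
  obtain ⟨C, hC⟩ := hK.exists_bound_of_continuousOn (f := f) hf.continuousOn
  refine ⟨C, fun g => hC _ fun i _ j _ => ?_⟩
  rw [mem_closedBall_zero_iff]
  exact entry_norm_bound_of_unitary (Matrix.mem_specialUnitaryGroup_iff.1 g.2).1 i j

instance : BorelSpace (Matrix (Fin 2) (Fin 2) ℂ) :=
  inferInstanceAs (BorelSpace (Fin 2 → Fin 2 → ℂ))

instance : SecondCountableTopology (Matrix (Fin 2) (Fin 2) ℂ) :=
  inferInstanceAs (SecondCountableTopology (Fin 2 → Fin 2 → ℂ))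

instance : BorelSpace SU2 := Subtype.borelSpace _

theorem gaussian_haar_reduction
    (J : ℕ) (f : Matrix (Fin 2) (Fin 2) ℂ → ℂ) (hf : Continuous f)
    (hhom : ∀ r : ℝ, 0 ≤ r → ∀ g : Matrix (Fin 2) (Fin 2) ℂ,
      f (r • g) = (r : ℂ) ^ (2 * J) * f g)
    (μ : Measure SU2) [IsProbabilityMeasure μ] [μ.IsMulLeftInvariant] :
    (∫ z : Spinor, f (Gmat z) * (gdens z : ℂ))
      = (Nat.factorial (J + 1) : ℂ)
          * ∫ g : SU2, f (g : Matrix (Fin 2) (Fin 2) ℂ) ∂μ := by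
  have hpolar : ∀ z : Spinor, ∃ v : SU2, ∀ u : SU2, f (Gmat z * u)
      = ((spinorNormSq z ^ J : ℝ) : ℂ) * f ((v * u : SU2) : Matrix (Fin 2) (Fin 2) ℂ) := by
    intro z
    obtain ⟨v, hv⟩ := exists_Gmat_eq_smul z
    refine ⟨v, fun u => ?_⟩
    rw [hv, Matrix.smul_mul, hhom _ (Real.sqrt_nonneg _), pow_mul, ← Complex.ofReal_pow,
      Real.sq_sqrt (spinorNormSq_nonneg z), Complex.ofReal_pow]
    rfl
  have hint : Integrable (Function.uncurry fun (u : SU2) (z : Spinor) =>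
      f (Gmat z * u) * (gdens z : ℂ)) (μ.prod volume) := by
    obtain ⟨C, hC⟩ := exists_bound_on_SU2 f hf
    have hcont : Continuous (Function.uncurry fun (u : SU2) (z : Spinor) =>
        f (Gmat z * u) * (gdens z : ℂ)) :=
      (hf.comp ((continuous_Gmat.comp continuous_snd).mul
        (continuous_subtype_val.comp continuous_fst))).mul
        (Complex.continuous_ofReal.comp (continuous_gdens.comp continuous_snd))
    refine (((integrable_spinorNormSq_pow_mul_gdens J).const_mul C).comp_snd μ).mono'
      hcont.aestronglyMeasurable (.of_forall fun ⟨u, z⟩ => ?_)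
    obtain ⟨v, hv⟩ := hpolar z
    have h0 : 0 ≤ spinorNormSq z ^ J := pow_nonneg (spinorNormSq_nonneg z) J
    simp only [Function.uncurry_apply_pair]
    rw [hv, norm_mul, norm_mul, Complex.norm_real, Complex.norm_real, Real.norm_of_nonneg h0,
      Real.norm_of_nonneg (gdens_nonneg z)]
    calc _ ≤ spinorNormSq z ^ J * C * gdens z := by
          gcongr
          · exact gdens_nonneg z
          · exact hC _
      _ = _ := by ring
  calc ∫ z : Spinor, f (Gmat z) * (gdens z : ℂ)
      = ∫ u : SU2, ∫ z : Spinor, f (Gmat z * u) * (gdens z : ℂ) ∂volume ∂μ := by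
        simp only [integral_Gmat_mul f hf, integral_const, probReal_univ, one_smul]
    _ = ∫ z : Spinor, ∫ u : SU2, f (Gmat z * u) * (gdens z : ℂ) ∂μ :=
        integral_integral_swap hint
    _ = ∫ z : Spinor, ((spinorNormSq z ^ J * gdens z : ℝ) : ℂ) * ∫ g : SU2, f g ∂μ := by
        refine integral_congr_ae (.of_forall fun z => ?_)
        obtain ⟨v, hv⟩ := hpolar z
        simp only [hv]
        rw [integral_mul_const, integral_const_mul,
          integral_mul_left_eq_self (fun g : SU2 => f g) v]
        push_cast
        ring
    _ = _ := by
        rw [integral_mul_const, integral_complex_ofReal, integral_spinorNormSq_pow_mul_gdens,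
          Complex.ofReal_natCast]
end
end

section
/- Let n ≥ 1 and let M be an n×n complex matrix whose Hermitian part (1/2)(M + Mᴴ) is positive definite. Then the function α ↦ exp(−Σ_{i,j} conj(α_i)·M_{ij}·α_j) is Lebesgue-integrable on ℂⁿ, det M ≠ 0, and ∫_{ℂⁿ} exp(−Σ_{i,j} conj(α_i)·M_{ij}·α_j) dα = πⁿ / det(M), where dα denotes Lebesgue measure on ℂⁿ ≅ ℝ^{2n}. -/
noncomputable section

open MeasureTheory

open scoped Matrix MatrixOrder ComplexOrder

lemma Matrix.PosDef.exists_isUnit_conjTranspose_mul_self {ι : Type*} [Fintype ι] [DecidableEq ι]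
    {H : Matrix ι ι ℂ} (hH : H.PosDef) : ∃ B : Matrix ι ι ℂ, IsUnit B ∧ H = Bᴴ * B := by
  obtain ⟨B, hB⟩ := CStarAlgebra.nonneg_iff_eq_star_mul_self.mp hH.posSemidef.nonneg
  refine ⟨B, ?_, hB⟩
  have h : IsUnit (Bᴴ * B) := by
    rw [← Matrix.star_eq_conjTranspose, ← hB]; exact hH.isUnit
  rw [Matrix.isUnit_iff_isUnit_det] at h ⊢
  rw [Matrix.det_mul] at h
  exact isUnit_of_mul_isUnit_right h

lemma Matrix.IsHermitian.exists_unitary_diagonal {ι : Type*} [Fintype ι] [DecidableEq ι]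
    {K : Matrix ι ι ℂ} (hK : K.IsHermitian) :
    ∃ (U : Matrix ι ι ℂ) (d : ι → ℝ), Uᴴ * U = 1 ∧ K = Uᴴ * diagonal (fun i => (d i : ℂ)) * U := by
  refine ⟨(star hK.eigenvectorUnitary : Matrix.unitaryGroup ι ℂ), hK.eigenvalues, ?_, ?_⟩
  · simp [← Matrix.star_eq_conjTranspose]
  · conv_lhs => rw [hK.spectral_theorem, Unitary.conjStarAlgAut_apply]
    simp [← Matrix.star_eq_conjTranspose, Function.comp_def]

/-- Simultaneous diagonalization by congruence of the Hermitian and skew-Hermitian parts. -/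
lemma Matrix.PosDef.exists_congr_diagonal {ι : Type*} [Fintype ι] [DecidableEq ι]
    {M : Matrix ι ι ℂ} (hM : ((1 / 2 : ℂ) • (M + Mᴴ)).PosDef) :
    ∃ (C : Matrix ι ι ℂ) (d : ι → ℝ), C.det ≠ 0 ∧
      M = Cᴴ * diagonal (fun i => 1 + Complex.I * (d i : ℂ)) * C := by
  obtain ⟨B, hB, hMB⟩ := hM.exists_isUnit_conjTranspose_mul_self
  have hBd : IsUnit B.det := (Matrix.isUnit_iff_isUnit_det B).mp hB
  have h1 : B * B⁻¹ = 1 := Matrix.mul_nonsing_inv B hBd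
  have h2 : B⁻¹ * B = 1 := Matrix.nonsing_inv_mul B hBd
  have h3 : Bᴴ * (B⁻¹)ᴴ = 1 := by rw [← Matrix.conjTranspose_mul, h2, Matrix.conjTranspose_one]
  have h4 : (B⁻¹)ᴴ * Bᴴ = 1 := by rw [← Matrix.conjTranspose_mul, h1, Matrix.conjTranspose_one]
  set N := (B⁻¹)ᴴ * M * B⁻¹ with hN
  have hMN : M = Bᴴ * N * B := by
    calc M = (Bᴴ * (B⁻¹)ᴴ) * M * (B⁻¹ * B) := by rw [h3, h2, one_mul, mul_one]
      _ = _ := by simp only [hN, mul_assoc]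
  have hNN : (1 / 2 : ℂ) • (N + Nᴴ) = 1 := by
    calc (1 / 2 : ℂ) • (N + Nᴴ) = (B⁻¹)ᴴ * ((1 / 2 : ℂ) • (M + Mᴴ)) * B⁻¹ := by
          simp [hN, mul_add, add_mul, mul_assoc, Matrix.conjTranspose_mul]
      _ = ((B⁻¹)ᴴ * Bᴴ) * (B * B⁻¹) := by rw [hMB]; simp only [mul_assoc]
      _ = 1 := by rw [h4, h1, one_mul]
  have hNs : Nᴴ = (2 : ℂ) • 1 - N := by
    rw [← hNN, smul_smul]; norm_num
  have hK : (-Complex.I • (N - 1)).IsHermitian := by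
    rw [Matrix.IsHermitian, Matrix.conjTranspose_smul, Matrix.conjTranspose_sub, hNs,
      Matrix.conjTranspose_one]
    simp only [star_neg, Complex.star_def, Complex.conj_I, two_smul]
    module
  obtain ⟨U, d, hU, hd⟩ := hK.exists_unitary_diagonal
  have hNd : N = Uᴴ * diagonal (fun i => 1 + Complex.I * (d i : ℂ)) * U := by
    have e : diagonal (fun i => 1 + Complex.I * (d i : ℂ))
        = 1 + Complex.I • diagonal (fun i => (d i : ℂ)) := by
      rw [← Matrix.diagonal_one, ← Matrix.diagonal_smul, Matrix.diagonal_add]; rfl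
    rw [e, mul_add, add_mul, mul_one, hU, Matrix.mul_smul, Matrix.smul_mul, ← hd, smul_smul]
    simp
  refine ⟨U * B, d, ?_, ?_⟩
  · rw [Matrix.det_mul]
    refine mul_ne_zero (fun h => ?_) hBd.ne_zero
    have := congrArg Matrix.det hU
    simp [h] at this
  · rw [hMN, hNd, Matrix.conjTranspose_mul]; simp only [mul_assoc]

lemma integrable_cexp_neg_sum_mul_norm_sq {ι : Type*} [Fintype ι] {b : ι → ℂ}
    (hb : ∀ i, 0 < (b i).re) :
    Integrable (fun z : ι → ℂ => Complex.exp (-∑ i, b i * (‖z i‖ : ℂ) ^ 2)) := by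
  simp_rw [← Finset.sum_neg_distrib, Complex.exp_sum]
  refine Integrable.fintype_prod (f := fun i (z : ℂ) => Complex.exp (-(b i * (‖z‖ : ℂ) ^ 2)))
    fun i => ?_
  simpa using GaussianFourier.integrable_cexp_neg_mul_sq_norm_add (hb i) 0 (0 : ℂ)

lemma integral_cexp_neg_sum_mul_norm_sq {ι : Type*} [Fintype ι] {b : ι → ℂ}
    (hb : ∀ i, 0 < (b i).re) :
    ∫ z : ι → ℂ, Complex.exp (-∑ i, b i * (‖z i‖ : ℂ) ^ 2) = ∏ i, (Real.pi : ℂ) / b i := by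
  simp_rw [← Finset.sum_neg_distrib, Complex.exp_sum]
  rw [integral_fintype_prod_volume_eq_prod
    (f := fun i (z : ℂ) => Complex.exp (-(b i * (‖z‖ : ℂ) ^ 2)))]
  refine Finset.prod_congr rfl fun i _ => ?_
  simpa using GaussianFourier.integral_cexp_neg_mul_sq_norm (V := ℂ) (hb i)

/-- A complex matrix scales Lebesgue measure on `ℂⁿ` by the squared modulus of its determinant. -/
lemma map_mulVec_volume_eq_smul {ι : Type*} [Fintype ι] [DecidableEq ι]
    {C : Matrix ι ι ℂ} (hC : C.det ≠ 0) :
    Measure.map (fun z : ι → ℂ => C *ᵥ z) volume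
      = ENNReal.ofReal (Complex.normSq C.det)⁻¹ • volume := by
  have hdet : LinearMap.det ((Matrix.toLin' C).restrictScalars ℝ) = Complex.normSq C.det := by
    rw [LinearMap.det_restrictScalars, Algebra.norm_complex_apply, LinearMap.det_toLin']
  have h := Measure.map_linearMap_addHaar_eq_smul_addHaar (volume : Measure (ι → ℂ))
    (f := (Matrix.toLin' C).restrictScalars ℝ) (by simpa [hdet] using hC)
  rw [hdet, abs_of_nonneg (inv_nonneg.mpr (Complex.normSq_nonneg _))] at h
  exact h

lemma integrable_comp_mulVec {ι E : Type*} [Fintype ι] [DecidableEq ι] [NormedAddCommGroup E]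
    {C : Matrix ι ι ℂ} (hC : C.det ≠ 0) {f : (ι → ℂ) → E} (hf : Integrable f) :
    Integrable (fun z => f (C *ᵥ z)) := by
  have h : Integrable f (Measure.map (fun z : ι → ℂ => C *ᵥ z) volume) := by
    rw [map_mulVec_volume_eq_smul hC]
    exact hf.smul_measure ENNReal.ofReal_ne_top
  exact h.comp_measurable (by fun_prop)

lemma integral_comp_mulVec {ι E : Type*} [Fintype ι] [DecidableEq ι] [NormedAddCommGroup E]
    [NormedSpace ℝ E] {C : Matrix ι ι ℂ} (hC : C.det ≠ 0) {f : (ι → ℂ) → E}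
    (hf : AEStronglyMeasurable f) :
    ∫ z, f (C *ᵥ z) = (Complex.normSq C.det)⁻¹ • ∫ z, f z := by
  have hmap := map_mulVec_volume_eq_smul hC
  rw [← integral_map (φ := fun z : ι → ℂ => C *ᵥ z) (by fun_prop)
    (by rw [hmap]; exact hf.smul_measure _), hmap, integral_smul_measure,
    ENNReal.toReal_ofReal (inv_nonneg.mpr (Complex.normSq_nonneg _))]

lemma Matrix.sum_star_mul_mul_eq_dotProduct {ι : Type*} [Fintype ι] (M : Matrix ι ι ℂ)
    (z : ι → ℂ) :
    ∑ i, ∑ j, starRingEnd ℂ (z i) * M i j * z j = star z ⬝ᵥ M *ᵥ z := by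
  simp [dotProduct, mulVec, Finset.mul_sum, mul_assoc]

lemma Matrix.posDef_hermitianPart {ι : Type*} [Fintype ι] {M : Matrix ι ι ℂ}
    (hM : ∀ z : ι → ℂ, z ≠ 0 → 0 < (star z ⬝ᵥ M *ᵥ z).re) :
    ((1 / 2 : ℂ) • (M + Mᴴ)).PosDef := by
  refine PosDef.of_dotProduct_mulVec_pos ?_ fun z hz => ?_
  · simp [IsHermitian, add_comm]
  · have h : star z ⬝ᵥ Mᴴ *ᵥ z = star (star z ⬝ᵥ M *ᵥ z) := by
      rw [star_dotProduct, star_mulVec, ← dotProduct_mulVec, conjTranspose_conjTranspose]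
    have e : star z ⬝ᵥ ((1 / 2 : ℂ) • (M + Mᴴ)) *ᵥ z = ((star z ⬝ᵥ M *ᵥ z).re : ℂ) := by
      rw [smul_mulVec, dotProduct_smul, add_mulVec, dotProduct_add, h, Complex.star_def,
        Complex.add_conj, smul_eq_mul]
      push_cast; ring
    rw [e]
    exact_mod_cast hM z hz

lemma Matrix.star_dotProduct_congr_diagonal {ι : Type*} [Fintype ι] [DecidableEq ι]
    (C : Matrix ι ι ℂ) (b z : ι → ℂ) :
    star z ⬝ᵥ (Cᴴ * diagonal b * C) *ᵥ z = ∑ i, b i * (‖(C *ᵥ z) i‖ : ℂ) ^ 2 := by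
  rw [← mulVec_mulVec, ← mulVec_mulVec, dotProduct_mulVec, ← star_mulVec, dotProduct]
  refine Finset.sum_congr rfl fun i _ => ?_
  rw [mulVec_diagonal, Pi.star_apply, Complex.star_def, ← Complex.conj_mul']
  ring

theorem complex_gaussian_integral
    (n : ℕ) (hn : 1 ≤ n) (M : Matrix (Fin n) (Fin n) ℂ)
    (hpos : ∀ α : Fin n → ℂ, α ≠ 0 →
      0 < (∑ i : Fin n, ∑ j : Fin n,
        starRingEnd ℂ (α i) * M i j * α j).re) :
    Integrable (fun α : Fin n → ℂ =>
        Complex.exp (-(∑ i : Fin n, ∑ j : Fin n,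
          starRingEnd ℂ (α i) * M i j * α j))) volume
    ∧ M.det ≠ 0
    ∧ (∫ α : Fin n → ℂ,
        Complex.exp (-(∑ i : Fin n, ∑ j : Fin n,
          starRingEnd ℂ (α i) * M i j * α j)))
      = (Real.pi : ℂ) ^ n / M.det := by
  simp_rw [Matrix.sum_star_mul_mul_eq_dotProduct] at hpos ⊢
  obtain ⟨C, d, hC, rfl⟩ := (Matrix.posDef_hermitianPart hpos).exists_congr_diagonal
  set b : Fin n → ℂ := fun i => 1 + Complex.I * (d i : ℂ)
  have hb : ∀ i, 0 < (b i).re := fun i => by simp [b]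
  have hb0 : ∏ i, b i ≠ 0 :=
    Finset.prod_ne_zero_iff.mpr fun i _ h => by simpa [h] using hb i
  have hint := integrable_cexp_neg_sum_mul_norm_sq hb
  have hdet : (Cᴴ * Matrix.diagonal b * C).det = Complex.normSq C.det * ∏ i, b i := by
    rw [Matrix.det_mul, Matrix.det_mul, Matrix.det_conjTranspose, Matrix.det_diagonal,
      Complex.normSq_eq_conj_mul_self, Complex.star_def]
    ring
  have hn0 : (Complex.normSq C.det : ℂ) ≠ 0 := by simpa using hC
  simp_rw [Matrix.star_dotProduct_congr_diagonal]
  refine ⟨integrable_comp_mulVec hC hint, hdet ▸ mul_ne_zero hn0 hb0, ?_⟩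
  rw [integral_comp_mulVec hC hint.aestronglyMeasurable, integral_cexp_neg_sum_mul_norm_sq hb,
    hdet, Finset.prod_div_distrib, Finset.prod_const, Finset.card_univ, Fintype.card_fin,
    Complex.real_smul, Complex.ofReal_inv]
  field_simp
end
end

section
/- Let T = (τ_ij) be an antisymmetric 3×3 complex matrix (τ_ji = −τ_ij, τ_ii = 0), and let conj(T) denote its entrywise complex conjugate. Then det(I₃ + T·conj(T)) = (1 − |τ₁₂|² − |τ₁₃|² − |τ₂₃|²)². -/
/-!
STATEMENT 12: for an antisymmetric 3×3 complex matrix T,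
det(I₃ + T·conj(T)) = (1 − |τ₁₂|² − |τ₁₃|² − |τ₂₃|²)².
-/

theorem det_one_add_antisym_mul_conj_three
    (T : Matrix (Fin 3) (Fin 3) ℂ)
    (hanti : ∀ i j, T j i = - T i j) (hdiag : ∀ i, T i i = 0) :
    (1 + T * T.map (starRingEnd ℂ)).det =
      ((1 : ℂ) - (Complex.normSq (T 0 1) : ℂ) - (Complex.normSq (T 0 2) : ℂ)
        - (Complex.normSq (T 1 2) : ℂ)) ^ 2 := by
  simp only [← Complex.mul_conj]
  rw [Matrix.det_fin_three]
  simp only [Matrix.add_apply, Matrix.mul_apply, Fin.sum_univ_three, Matrix.map_apply,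
    Matrix.one_apply, hdiag, hanti 0 1, hanti 0 2, hanti 1 2, map_neg, map_zero, Fin.reduceEq,
    if_true, if_false]
  ring
end
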